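/- arXiv:2405.13257 — 2 statements merged into one kernel-verified Lean document; each statement's English description precedes it below -/
import Mathlib

section
/- Let R be a principal ideal domain and let (A,d_A) and (B,d_B) be differential graded algebras over R such that H^0(A)=H^0(B)=R, H^1(A)=H^1(B)=0, all H^i(A) and H^i(B) are finitely generated R-modules, H^2(B) is a free R-module, and A is free as an R-module. Let f:(A,d_A)→(B,d_B) be a morphism of R-dgas such that H^2(f):H^2(A)→H^2(B) is injective. Then there exists a free R-module V, a differential d on the free product A⊔TV of A with the tensor algebra TV extending d_A, and a quasi-isomorphism of R-dgas φ:(A⊔TV,d)→(B,d_B) such that φ∘i=f, where i:(A,d_A)↪(A⊔TV,d) is the canonical inclusion. -/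
/-!
Common framework: graded differential algebras over a commutative ring `R`,
their cohomology, quasi-isomorphisms, free (product) and free commutative
extensions (relative free models `A ⊔ TV` and relative commutative models
`A ⊗ ΛV`), minimality, H-mildness, and the packages of data used to define
`secat`, `sc` and their variants following Benzaki–Rami.
-/

namespace MildTC

universe u

/-- A differential on a graded `R`-algebra `A` (graded by `𝒜 : ℕ → Submodule R A`):
an `R`-linear map of degree `1`, squaring to zero and satisfying the graded
Leibniz rule.  Together with the grading this makes `A` a dga over `R`. -/
structure Differential (R : Type u) [CommRing R] {A : Type u} [Ring A] [Algebra R A]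
    (𝒜 : ℕ → Submodule R A) : Type u where
  d : A →ₗ[R] A
  d_squared : ∀ a : A, d (d a) = 0
  d_degree : ∀ i : ℕ, ∀ a ∈ 𝒜 i, d a ∈ 𝒜 (i + 1)
  leibniz : ∀ i j : ℕ, ∀ a ∈ 𝒜 i, ∀ b ∈ 𝒜 j,
    d (a * b) = d a * b + ((-1 : ℤ) ^ i) • (a * d b)

/-- Graded commutativity (the Koszul sign rule): the condition making a graded
algebra a *commutative* graded algebra. -/
def GradedComm {R : Type u} [CommRing R] {A : Type u} [Ring A] [Algebra R A]
    (𝒜 : ℕ → Submodule R A) : Prop :=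
  ∀ i j : ℕ, ∀ a ∈ 𝒜 i, ∀ b ∈ 𝒜 j, a * b = ((-1 : ℤ) ^ (i * j)) • (b * a)

section Cohomology

variable {R : Type u} [CommRing R]
variable {A : Type u} [Ring A] [Algebra R A] {𝒜 : ℕ → Submodule R A}
variable {B : Type u} [Ring B] [Algebra R B] {ℬ : ℕ → Submodule R B}

/-- Cocycles of degree `i`. -/
def cocycles (D : Differential R 𝒜) (i : ℕ) : Submodule R A :=
  𝒜 i ⊓ LinearMap.ker D.d

/-- Coboundaries of degree `i`. -/
def cobounds (D : Differential R 𝒜) (i : ℕ) : Submodule R A :=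
  𝒜 i ⊓ LinearMap.range D.d

/-- The degree `i` cohomology `H^i(A,d)` of a dga, as an `R`-module. -/
abbrev cohomology (D : Differential R 𝒜) (i : ℕ) : Type u :=
  ↥(cocycles D i) ⧸ (cobounds D i).comap (cocycles D i).subtype

/-- A morphism of dgas: an algebra morphism preserving degrees and commuting with
the differentials. -/
structure IsDGAHom (DA : Differential R 𝒜) (DB : Differential R ℬ)
    (f : A →ₐ[R] B) : Prop where
  map_degree : ∀ i : ℕ, ∀ a ∈ 𝒜 i, f a ∈ ℬ i
  comm_d : ∀ a : A, f (DA.d a) = DB.d (f a)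

/-- The map `H^i(f)` induced in cohomology by a dga morphism. -/
def inducedH (DA : Differential R 𝒜) (DB : Differential R ℬ) (f : A →ₐ[R] B)
    (hf : IsDGAHom DA DB f) (i : ℕ) :
    cohomology DA i →ₗ[R] cohomology DB i := by
  have hres : ∀ x ∈ cocycles DA i, f.toLinearMap x ∈ cocycles DB i := by
    intro a ha
    rcases Submodule.mem_inf.1 ha with ⟨h1, h2⟩
    refine Submodule.mem_inf.2 ⟨hf.map_degree i a h1, ?_⟩
    have h2' : DA.d a = 0 := h2
    show DB.d (f a) = 0
    rw [← hf.comm_d a, h2', map_zero]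
  refine Submodule.mapQ _ _ (LinearMap.restrict f.toLinearMap hres) ?_
  intro x hx
  simp only [Submodule.mem_comap] at hx ⊢
  rcases Submodule.mem_inf.1 hx with ⟨h1, h2⟩
  rcases h2 with ⟨c, hc⟩
  have hcoe : ((LinearMap.restrict f.toLinearMap hres) x : B) = f (x : A) := rfl
  refine Submodule.mem_inf.2 ⟨?_, ?_⟩
  · show ((LinearMap.restrict f.toLinearMap hres) x : B) ∈ ℬ i
    rw [hcoe]; exact hf.map_degree i _ h1
  · refine ⟨f c, ?_⟩
    show DB.d (f c) = f (x : A)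
    rw [← hf.comm_d c, hc]
    rfl

/-- A quasi-isomorphism of dgas: a dga morphism inducing isomorphisms in cohomology. -/
def IsQuasiIso (DA : Differential R 𝒜) (DB : Differential R ℬ) (f : A →ₐ[R] B)
    (hf : IsDGAHom DA DB f) : Prop :=
  ∀ i : ℕ, Function.Bijective (inducedH DA DB f hf i)

end Cohomology

/-- A bundled graded differential `R`-algebra. -/
structure GradedDGA (R : Type u) [CommRing R] : Type (u + 1) where
  carrier : Type u
  [ring : Ring carrier]
  [alg : Algebra R carrier]
  grading : ℕ → Submodule R carrier
  [graded : GradedAlgebra grading]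
  diff : Differential R grading

attribute [instance] GradedDGA.ring GradedDGA.alg GradedDGA.graded

section Mild

variable {R : Type u} [CommRing R]
variable {A : Type u} [Ring A] [Algebra R A] {𝒜 : ℕ → Submodule R A}

/-- `ρ(R)`: the least prime of `ℕ` that is not invertible in `R` (`∞` if none). -/
noncomputable def rhoPID (R : Type u) [CommRing R] : ℕ∞ :=
  sInf {q : ℕ∞ | ∃ p : ℕ, q = (p : ℕ∞) ∧ p.Prime ∧ ¬ IsUnit (p : R)}

/-- A dga is `(r,l)`-H-mild when its (reduced) homology is concentrated in
degrees `r+1` through `l` inclusive. -/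
def IsHMild (D : Differential R 𝒜) (r : ℕ) (l : ℕ∞) : Prop :=
  ∀ i : ℕ, 1 ≤ i → ¬(r + 1 ≤ i ∧ (i : ℕ∞) ≤ l) → Subsingleton (cohomology D i)

/-- Condition (★): the homology is of finite type, `H^0 = R`, `H^i = 0` for
`1 ≤ i ≤ r` and `H^{r+1}` is `R`-free. -/
def StarCondition (D : Differential R 𝒜) (r : ℕ) : Prop :=
  (∀ i : ℕ, Module.Finite R (cohomology D i)) ∧
  Nonempty (cohomology D 0 ≃ₗ[R] R) ∧
  (∀ i : ℕ, 1 ≤ i → i ≤ r → Subsingleton (cohomology D i)) ∧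
  Module.Free R (cohomology D (r + 1))

end Mild

section FreeExtensions

variable {R : Type u} [CommRing R]
variable {A : Type u} [Ring A] [Algebra R A]
variable {E : Type u} [Ring E] [Algebra R E]

/-- `ι : A → E` together with the graded free submodule family `V` exhibits `E`
as the free product `A ⊔ T(V)` of `A` with the tensor algebra on `V`,
via the universal property of the coproduct of algebras. -/
def IsFreeProductExtension (ℰ : ℕ → Submodule R E) (ι : A →ₐ[R] E)
    (V : ℕ → Submodule R E) : Prop :=
  (∀ n : ℕ, V n ≤ ℰ n) ∧ (∀ n : ℕ, Module.Free R (V n)) ∧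
  ∀ (C : Type u) [Ring C] [Algebra R C],
    ∀ (g : A →ₐ[R] C) (h : ∀ n : ℕ, V n →ₗ[R] C),
    ∃! φ : E →ₐ[R] C, φ.comp ι = g ∧ ∀ (n : ℕ) (v : V n), φ v = h n v

/-- `ι : A → E` together with the graded free submodule family `V` exhibits `E`
as `A ⊗ ΛV`, the (relative) free commutative extension of `A` on `V`, via the
universal property of the coproduct in the category of graded-commutative
graded `R`-algebras. -/
def IsFreeCommExtension (𝒜 : ℕ → Submodule R A) (ℰ : ℕ → Submodule R E)
    (ι : A →ₐ[R] E) (V : ℕ → Submodule R E) : Prop :=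
  (∀ n : ℕ, V n ≤ ℰ n) ∧ (∀ n : ℕ, Module.Free R (V n)) ∧
  ∀ (C : Type u) [Ring C] [Algebra R C] (𝒞 : ℕ → Submodule R C),
    GradedComm 𝒞 →
    ∀ (g : A →ₐ[R] C), (∀ i : ℕ, ∀ a ∈ 𝒜 i, g a ∈ 𝒞 i) →
    ∀ (h : ∀ n : ℕ, V n →ₗ[R] C), (∀ (n : ℕ) (v : V n), h n v ∈ 𝒞 n) →
    ∃! φ : E →ₐ[R] C, φ.comp ι = g ∧ ∀ (n : ℕ) (v : V n), φ v = h n v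

/-- `T` is the free (tensor) graded algebra `T(V)` on the graded free family `V`. -/
def IsFreeAlgebraOn (T : GradedDGA R) (V : ℕ → Submodule R T.carrier) : Prop :=
  (∀ n : ℕ, V n ≤ T.grading n) ∧ (∀ n : ℕ, Module.Free R (V n)) ∧
  ∀ (C : Type u) [Ring C] [Algebra R C],
    ∀ (h : ∀ n : ℕ, V n →ₗ[R] C),
    ∃! φ : T.carrier →ₐ[R] C, ∀ (n : ℕ) (v : V n), φ v = h n v

/-- `M` is the free graded-commutative algebra `ΛV` on the graded free family `V`. -/
def IsFreeCommAlgebraOn (M : GradedDGA R) (V : ℕ → Submodule R M.carrier) : Prop :=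
  (∀ n : ℕ, V n ≤ M.grading n) ∧ (∀ n : ℕ, Module.Free R (V n)) ∧
  ∀ (C : Type u) [Ring C] [Algebra R C] (𝒞 : ℕ → Submodule R C),
    GradedComm 𝒞 →
    ∀ (h : ∀ n : ℕ, V n →ₗ[R] C), (∀ (n : ℕ) (v : V n), h n v ∈ 𝒞 n) →
    ∃! φ : M.carrier →ₐ[R] C, ∀ (n : ℕ) (v : V n), φ v = h n v

end FreeExtensions

section Minimality

variable {R : Type u} [CommRing R]
variable {A : Type u} [Ring A] [Algebra R A] {𝒜 : ℕ → Submodule R A}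

/-- The differential is decomposable on the generating family `V`:
`d(V) ⊆ (span V)·(span V)` (i.e. `d(V) ⊆ T^{≥2}V`, resp. `Λ^{≥2}V`). -/
def IsDecomposable (D : Differential R 𝒜) (V : ℕ → Submodule R A) : Prop :=
  ∀ n : ℕ, ∀ v ∈ V n,
    D.d v ∈ (Submodule.span R (⋃ k, (V k : Set A))) * (Submodule.span R (⋃ k, (V k : Set A)))

/-- Minimality of a (relative) free dga with generating family `V`:
decomposability of the differential when `R` is a field, and in general, for
every degree `i` there is a non-invertible `r_i ∈ R` with `d(V^i) ⊆ r_i·(degree i+1 part)`. -/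
def IsMinimal (D : Differential R 𝒜) (V : ℕ → Submodule R A) : Prop :=
  (IsField R → IsDecomposable D V) ∧
  (¬ IsField R → ∀ i : ℕ, ∃ r : R, ¬ IsUnit r ∧
    ∀ v ∈ V i, ∃ w ∈ 𝒜 (i + 1), D.d v = r • w)

end Minimality

section TensorPower

variable {R : Type u} [CommRing R]
variable {A : Type u} [Ring A] [Algebra R A] {𝒜 : ℕ → Submodule R A}

/-- `T`, with the `m` inclusions `incl j : A → T`, is the `m`-fold tensor power
`A^{⊗m}` of the commutative dga `A`: the `m`-fold coproduct of `A` in the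
category of graded-commutative dgas. -/
def IsTensorPower (DA : Differential R 𝒜) (m : ℕ) (T : GradedDGA R)
    (incl : Fin m → (A →ₐ[R] T.carrier)) : Prop :=
  GradedComm T.grading ∧ (∀ j, IsDGAHom DA T.diff (incl j)) ∧
  ∀ (C : Type u) [Ring C] [Algebra R C] (𝒞 : ℕ → Submodule R C),
    GradedComm 𝒞 →
    ∀ (g : Fin m → (A →ₐ[R] C)), (∀ j, ∀ i : ℕ, ∀ a ∈ 𝒜 i, g j a ∈ 𝒞 i) →
    ∃! h : T.carrier →ₐ[R] C, ∀ j, h.comp (incl j) = g j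

/-- `T`, with the `m` inclusions `incl j : A → T`, is the `m`-fold (graded)
tensor power `A^{⊗m}` of the dga `A` (not necessarily commutative), via the
universal property of the graded tensor product of graded algebras. -/
def IsTensorPowerNC (DA : Differential R 𝒜) (m : ℕ) (T : GradedDGA R)
    (incl : Fin m → (A →ₐ[R] T.carrier)) : Prop :=
  (∀ j, IsDGAHom DA T.diff (incl j)) ∧
  (∀ j k : Fin m, j ≠ k → ∀ p q : ℕ, ∀ a ∈ 𝒜 p, ∀ b ∈ 𝒜 q,
    incl k b * incl j a = ((-1 : ℤ) ^ (p * q)) • (incl j a * incl k b)) ∧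
  ∀ (C : Type u) [Ring C] [Algebra R C] (𝒞 : ℕ → Submodule R C),
    ∀ (g : Fin m → (A →ₐ[R] C)), (∀ j, ∀ i : ℕ, ∀ a ∈ 𝒜 i, g j a ∈ 𝒞 i) →
    (∀ j k : Fin m, j ≠ k → ∀ p q : ℕ, ∀ a ∈ 𝒜 p, ∀ b ∈ 𝒜 q,
      g k b * g j a = ((-1 : ℤ) ^ (p * q)) • (g j a * g k b)) →
    ∃! h : T.carrier →ₐ[R] C, ∀ j, h.comp (incl j) = g j

end TensorPower

/-- `sInf` of a set of natural numbers, viewed in `ℕ∞` (`⊤` if empty). -/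
noncomputable def leastNat (P : ℕ → Prop) : ℕ∞ :=
  sInf {N : ℕ∞ | ∃ m : ℕ, N = (m : ℕ∞) ∧ P m}

/-- `sSup` of a set of natural numbers, viewed in `ℕ∞`. -/
noncomputable def greatestNat (P : ℕ → Prop) : ℕ∞ :=
  sSup {N : ℕ∞ | ∃ m : ℕ, N = (m : ℕ∞) ∧ P m}

section Nilpotency

variable {R : Type u} [CommRing R]
variable {A : Type u} [Ring A] [Algebra R A] {𝒜 : ℕ → Submodule R A}
variable {B : Type u} [Ring B] [Algebra R B] {ℬ : ℕ → Submodule R B}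

/-- `nil ker(H(φ))`: the length of the longest non-trivial product of elements
of `ker H(φ)`, expressed via homogeneous cocycle representatives. -/
noncomputable def nilKerH (DA : Differential R 𝒜) (DB : Differential R ℬ)
    (φ : A →ₐ[R] B) : ℕ∞ :=
  greatestNat (fun k =>
    ∃ (n : Fin k → ℕ) (a : Fin k → A),
      (∀ i, a i ∈ cocycles DA (n i)) ∧
      (∀ i, φ (a i) ∈ LinearMap.range DB.d) ∧
      (List.ofFn a).prod ∉ LinearMap.range DA.d)

/-- `nil ker(φ)`: the length of the longest non-trivial product of elements of
the ideal `ker φ`. -/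
noncomputable def nilKerAlg (φ : A →ₐ[R] B) : ℕ∞ :=
  greatestNat (fun k =>
    ∃ a : Fin k → A, (∀ i, φ (a i) = 0) ∧ (List.ofFn a).prod ≠ 0)

/-- An acyclic (two-sided, differential) ideal of a dga. -/
def IsAcyclicIdeal (D : Differential R 𝒜) (J : Submodule R A) : Prop :=
  (∀ x ∈ J, ∀ a : A, a * x ∈ J ∧ x * a ∈ J) ∧
  (∀ x ∈ J, D.d x ∈ J) ∧
  (∀ x ∈ J, D.d x = 0 → ∃ y ∈ J, D.d y = x)

/-- The homology nilpotency `Hnil I` of an ideal `I`: the least `k` such that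
`I^{k+1}` is contained in some acyclic ideal of `A`. -/
noncomputable def Hnil (D : Differential R 𝒜) (I : Submodule R A) : ℕ∞ :=
  leastNat (fun k => ∃ J : Submodule R A, IsAcyclicIdeal D J ∧ I ^ (k + 1) ≤ J)

end Nilpotency

section Packages

variable {R : Type u} [CommRing R]
variable {A : Type u} [Ring A] [Algebra R A] {𝒜 : ℕ → Submodule R A}
variable {B : Type u} [Ring B] [Algebra R B] {ℬ : ℕ → Submodule R B}

/-- All the data entering the definition of the sectional category `secat(φ)` of a
surjective morphism `φ : (A,d) → (B,d)` of cdgas: the tensor power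
`T = A^{⊗(m+1)}`, the `(m+1)`-fold multiplication `μ_{m+1}`, the projection
`p_m : A^{⊗(m+1)} → A^{⊗(m+1)}/(ker φ)^{⊗(m+1)}`, a commutative model
`i_m : A^{⊗(m+1)} ↪ A^{⊗(m+1)} ⊗ ΛW_{(m)}` of `p_m`, and the pushout
`j_m : A ↪ A ⊗ ΛW_{(m)}` of `i_m` along `μ_{m+1}`. -/
structure SecatPackage (DA : Differential R 𝒜) (DB : Differential R ℬ)
    (φ : A →ₐ[R] B) (m : ℕ) : Type (u + 1) where
  /-- the tensor power `A^{⊗(m+1)}` -/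
  T : GradedDGA R
  incl : Fin (m + 1) → (A →ₐ[R] T.carrier)
  T_power : IsTensorPower DA (m + 1) T incl
  /-- the `(m+1)`-fold multiplication `μ_{m+1} : A^{⊗(m+1)} → A` -/
  mul : T.carrier →ₐ[R] A
  mul_dga : IsDGAHom T.diff DA mul
  mul_incl : ∀ j, mul.comp (incl j) = AlgHom.id R A
  /-- the quotient `A^{⊗(m+1)}/(ker φ)^{⊗(m+1)}` -/
  Q : GradedDGA R
  Qcomm : GradedComm Q.grading
  p : T.carrier →ₐ[R] Q.carrier
  p_dga : IsDGAHom T.diff Q.diff p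
  p_surj : Function.Surjective p
  p_ker : LinearMap.ker p.toLinearMap =
    (List.ofFn fun j : Fin (m + 1) =>
      Submodule.map (incl j).toLinearMap (LinearMap.ker φ.toLinearMap)).prod
  /-- a commutative model `i_m` of `p_m`, with generating graded module `W_{(m)}` -/
  E : GradedDGA R
  Ecomm : GradedComm E.grading
  i : T.carrier →ₐ[R] E.carrier
  i_dga : IsDGAHom T.diff E.diff i
  W : ℕ → Submodule R E.carrier
  i_free : IsFreeCommExtension T.grading E.grading i W
  ψ : E.carrier →ₐ[R] Q.carrier
  ψ_dga : IsDGAHom E.diff Q.diff ψ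
  ψ_qiso : IsQuasiIso E.diff Q.diff ψ ψ_dga
  ψ_i : ψ.comp i = p
  /-- the pushout `A ⊗ ΛW_{(m)}` of `i_m` along `μ_{m+1}`, with inclusion `j_m` -/
  F : GradedDGA R
  Fcomm : GradedComm F.grading
  j : A →ₐ[R] F.carrier
  j_dga : IsDGAHom DA F.diff j
  bar : E.carrier →ₐ[R] F.carrier
  bar_dga : IsDGAHom E.diff F.diff bar
  square : bar.comp i = j.comp mul
  pushout : ∀ (C : GradedDGA R), GradedComm C.grading →
    ∀ (τ : E.carrier →ₐ[R] C.carrier), IsDGAHom E.diff C.diff τ →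
    ∀ (g : A →ₐ[R] C.carrier), IsDGAHom DA C.diff g →
    τ.comp i = g.comp mul →
    ∃! h : F.carrier →ₐ[R] C.carrier, h.comp bar = τ ∧ h.comp j = g

/-- `secat(φ)`: the least `m` such that `j_m` admits a cdga retraction. -/
noncomputable def secat {DA : Differential R 𝒜} {DB : Differential R ℬ}
    {φ : A →ₐ[R] B} (S : ∀ m : ℕ, SecatPackage DA DB φ m) : ℕ∞ :=
  leastNat (fun m => ∃ ret : (S m).F.carrier →ₐ[R] A,
    IsDGAHom (S m).F.diff DA ret ∧ ret.comp (S m).j = AlgHom.id R A)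

/-- `msecat(φ)`: the least `m` such that `j_m` admits an `A`-(dg-)module retraction. -/
noncomputable def msecat {DA : Differential R 𝒜} {DB : Differential R ℬ}
    {φ : A →ₐ[R] B} (S : ∀ m : ℕ, SecatPackage DA DB φ m) : ℕ∞ :=
  leastNat (fun m => ∃ ret : (S m).F.carrier →ₗ[R] A,
    (∀ i : ℕ, ∀ x ∈ (S m).F.grading i, ret x ∈ 𝒜 i) ∧
    (∀ x, ret ((S m).F.diff.d x) = DA.d (ret x)) ∧
    (∀ (a : A) (x : (S m).F.carrier), ret ((S m).j a * x) = a * ret x) ∧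
    (∀ a : A, ret ((S m).j a) = a))

/-- `Hsecat(φ)`: the least `m` such that `H(j_m)` is injective. -/
noncomputable def Hsecat {DA : Differential R 𝒜} {DB : Differential R ℬ}
    {φ : A →ₐ[R] B} (S : ∀ m : ℕ, SecatPackage DA DB φ m) : ℕ∞ :=
  leastNat (fun m => ∀ i : ℕ,
    Function.Injective (inducedH DA (S m).F.diff (S m).j (S m).j_dga i))

/-- All the data entering the definition of `sc(φ)` for a surjective morphism
`φ : (A,d) → (B,d)` of cdgas: the projection `Γ_m : A → A/(ker φ)^{m+1}` and a
commutative model `ι_m : A ↪ A ⊗ ΛV_{(m)}` of `Γ_m`. -/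
structure ScPackage (DA : Differential R 𝒜) (DB : Differential R ℬ)
    (φ : A →ₐ[R] B) (m : ℕ) : Type (u + 1) where
  /-- the quotient `A/(ker φ)^{m+1}` -/
  Q : GradedDGA R
  Qcomm : GradedComm Q.grading
  Γ : A →ₐ[R] Q.carrier
  Γ_dga : IsDGAHom DA Q.diff Γ
  Γ_surj : Function.Surjective Γ
  Γ_ker : LinearMap.ker Γ.toLinearMap = (LinearMap.ker φ.toLinearMap) ^ (m + 1)
  /-- a commutative model `ι_m : A ↪ A ⊗ ΛV_{(m)}` of `Γ_m` -/
  G : GradedDGA R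
  Gcomm : GradedComm G.grading
  ι : A →ₐ[R] G.carrier
  ι_dga : IsDGAHom DA G.diff ι
  V : ℕ → Submodule R G.carrier
  ι_free : IsFreeCommExtension 𝒜 G.grading ι V
  ψ : G.carrier →ₐ[R] Q.carrier
  ψ_dga : IsDGAHom G.diff Q.diff ψ
  ψ_qiso : IsQuasiIso G.diff Q.diff ψ ψ_dga
  ψ_ι : ψ.comp ι = Γ

/-- `sc(φ)`: the least `m` such that `ι_m` admits a cdga (homotopy) retraction. -/
noncomputable def sc {DA : Differential R 𝒜} {DB : Differential R ℬ}
    {φ : A →ₐ[R] B} (P : ∀ m : ℕ, ScPackage DA DB φ m) : ℕ∞ :=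
  leastNat (fun m => ∃ ret : (P m).G.carrier →ₐ[R] A,
    IsDGAHom (P m).G.diff DA ret ∧ ret.comp (P m).ι = AlgHom.id R A)

/-- `msc(φ)`: the least `m` such that `ι_m` admits an `A`-(dg-)module retraction. -/
noncomputable def msc {DA : Differential R 𝒜} {DB : Differential R ℬ}
    {φ : A →ₐ[R] B} (P : ∀ m : ℕ, ScPackage DA DB φ m) : ℕ∞ :=
  leastNat (fun m => ∃ ret : (P m).G.carrier →ₗ[R] A,
    (∀ i : ℕ, ∀ x ∈ (P m).G.grading i, ret x ∈ 𝒜 i) ∧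
    (∀ x, ret ((P m).G.diff.d x) = DA.d (ret x)) ∧
    (∀ (a : A) (x : (P m).G.carrier), ret ((P m).ι a * x) = a * ret x) ∧
    (∀ a : A, ret ((P m).ι a) = a))

/-- `Hsc(φ)`: the least `m` such that `H(Γ_m)` is injective. -/
noncomputable def Hsc {DA : Differential R 𝒜} {DB : Differential R ℬ}
    {φ : A →ₐ[R] B} (P : ∀ m : ℕ, ScPackage DA DB φ m) : ℕ∞ :=
  leastNat (fun m => ∀ i : ℕ,
    Function.Injective (inducedH DA (P m).Q.diff (P m).Γ (P m).Γ_dga i))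

/-- The analogue of `SecatPackage` in the category of (not necessarily
commutative) dgas: free models `A^{⊗(m+1)} ⊔ TW_{(m)}` (free products with
tensor algebras) replace commutative models. -/
structure ASecatPackage (DA : Differential R 𝒜) (DB : Differential R ℬ)
    (φ : A →ₐ[R] B) (m : ℕ) : Type (u + 1) where
  T : GradedDGA R
  incl : Fin (m + 1) → (A →ₐ[R] T.carrier)
  T_power : IsTensorPowerNC DA (m + 1) T incl
  mul : T.carrier →ₐ[R] A
  mul_dga : IsDGAHom T.diff DA mul
  mul_incl : ∀ j, mul.comp (incl j) = AlgHom.id R A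
  Q : GradedDGA R
  p : T.carrier →ₐ[R] Q.carrier
  p_dga : IsDGAHom T.diff Q.diff p
  p_surj : Function.Surjective p
  p_ker : LinearMap.ker p.toLinearMap =
    (List.ofFn fun j : Fin (m + 1) =>
      Submodule.map (incl j).toLinearMap (LinearMap.ker φ.toLinearMap)).prod
  /-- a free model `i_m : A^{⊗(m+1)} ↪ A^{⊗(m+1)} ⊔ TW_{(m)}` of `p_m` -/
  E : GradedDGA R
  i : T.carrier →ₐ[R] E.carrier
  i_dga : IsDGAHom T.diff E.diff i
  W : ℕ → Submodule R E.carrier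
  i_free : IsFreeProductExtension E.grading i W
  ψ : E.carrier →ₐ[R] Q.carrier
  ψ_dga : IsDGAHom E.diff Q.diff ψ
  ψ_qiso : IsQuasiIso E.diff Q.diff ψ ψ_dga
  ψ_i : ψ.comp i = p
  /-- the pushout `A ⊔ TW_{(m)}` of `i_m` along `μ_{m+1}`, with inclusion `j_m` -/
  F : GradedDGA R
  j : A →ₐ[R] F.carrier
  j_dga : IsDGAHom DA F.diff j
  bar : E.carrier →ₐ[R] F.carrier
  bar_dga : IsDGAHom E.diff F.diff bar
  square : bar.comp i = j.comp mul
  pushout : ∀ (C : GradedDGA R),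
    ∀ (τ : E.carrier →ₐ[R] C.carrier), IsDGAHom E.diff C.diff τ →
    ∀ (g : A →ₐ[R] C.carrier), IsDGAHom DA C.diff g →
    τ.comp i = g.comp mul →
    ∃! h : F.carrier →ₐ[R] C.carrier, h.comp bar = τ ∧ h.comp j = g

/-- `Asecat(φ)`: the least `m` such that `j_m` admits a dga retraction,
equivalently such that there is a dga morphism `τ` with `τ ∘ i_m = μ_{m+1}`. -/
noncomputable def Asecat {DA : Differential R 𝒜} {DB : Differential R ℬ}
    {φ : A →ₐ[R] B} (S : ∀ m : ℕ, ASecatPackage DA DB φ m) : ℕ∞ :=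
  leastNat (fun m => ∃ ret : (S m).F.carrier →ₐ[R] A,
    IsDGAHom (S m).F.diff DA ret ∧ ret.comp (S m).j = AlgHom.id R A)

/-- The analogue of `ScPackage` in the category of dgas: a free model
`ι_m : A ↪ A ⊔ TV_{(m)}` of the projection `Γ_m : A → A/(ker φ)^{m+1}`. -/
structure AScPackage (DA : Differential R 𝒜) (DB : Differential R ℬ)
    (φ : A →ₐ[R] B) (m : ℕ) : Type (u + 1) where
  Q : GradedDGA R
  Γ : A →ₐ[R] Q.carrier
  Γ_dga : IsDGAHom DA Q.diff Γ
  Γ_surj : Function.Surjective Γ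
  Γ_ker : LinearMap.ker Γ.toLinearMap = (LinearMap.ker φ.toLinearMap) ^ (m + 1)
  G : GradedDGA R
  ι : A →ₐ[R] G.carrier
  ι_dga : IsDGAHom DA G.diff ι
  V : ℕ → Submodule R G.carrier
  ι_free : IsFreeProductExtension G.grading ι V
  ψ : G.carrier →ₐ[R] Q.carrier
  ψ_dga : IsDGAHom G.diff Q.diff ψ
  ψ_qiso : IsQuasiIso G.diff Q.diff ψ ψ_dga
  ψ_ι : ψ.comp ι = Γ

/-- `Asc(φ)`: the least `m` such that `Γ_m` admits a homotopy retraction, i.e.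
`ι_m` admits a dga retraction. -/
noncomputable def Asc {DA : Differential R 𝒜} {DB : Differential R ℬ}
    {φ : A →ₐ[R] B} (P : ∀ m : ℕ, AScPackage DA DB φ m) : ℕ∞ :=
  leastNat (fun m => ∃ ret : (P m).G.carrier →ₐ[R] A,
    IsDGAHom (P m).G.diff DA ret ∧ ret.comp (P m).ι = AlgHom.id R A)

end Packages

section Spaces

variable (R : Type u) [CommRing R]

/-- Abstract packaging of a finite-type `(r,ρ(R))`-mild CW-complex `X` with
`H_*(ΩX;R)` torsion free, together with its (designated) cochain algebra
`C = C^*(X;R)` and its decomposable minimal commutative model `(ΛV,d)`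
(the commutative model of the Chevalley–Eilenberg complex `C^*(L)` of its
Anick–Halperin Lie model `L`). -/
structure MildSpaceModel (r : ℕ) : Type (u + 1) where
  /-- the underlying space -/
  X : Type u
  [topX : TopologicalSpace X]
  x₀ : X
  [pconn : PathConnectedSpace X]
  /-- `X` is `r`-connected -/
  rconn : ∀ k : ℕ, 1 ≤ k → k ≤ r → Subsingleton (HomotopyGroup (Fin k) X x₀)
  /-- the loop-space homology `H_n(ΩX;R)` -/
  LH : ℕ → Type u
  [lhAdd : ∀ n, AddCommGroup (LH n)]
  [lhMod : ∀ n, Module R (LH n)]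
  /-- `H_*(ΩX;R)` is of finite type -/
  lhFinite : ∀ n, Module.Finite R (LH n)
  /-- `H_*(ΩX;R)` is torsion free -/
  lhTorsionFree : ∀ n, NoZeroSMulDivisors R (LH n)
  /-- the cochain algebra `C^*(X;R)` (finite type, `r`-connected, of dimension
  `≤ rρ(R)`; this is the `(r,ρ(R))`-mildness of `X`) -/
  C : GradedDGA R
  C_mild : IsHMild C.diff r ((r : ℕ∞) * rhoPID R)
  C_star : StarCondition C.diff r
  /-- the decomposable minimal commutative model `(ΛV,d)` of `X` -/
  M : GradedDGA R
  Mcomm : GradedComm M.grading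
  V : ℕ → Submodule R M.carrier
  Vfin : ∀ n, Module.Finite R (V n)
  M_free : IsFreeCommAlgebraOn M V
  M_min : IsMinimal M.diff V
  M_dec : IsDecomposable M.diff V
  M_mild : IsHMild M.diff r ((r : ℕ∞) * rhoPID R)
  /-- the model computes the cohomology of `X` -/
  M_matches : ∀ n : ℕ, Nonempty (cohomology M.diff n ≃ₗ[R] cohomology C.diff n)

attribute [instance] MildSpaceModel.topX MildSpaceModel.pconn
  MildSpaceModel.lhAdd MildSpaceModel.lhMod

/-- Abstract packaging of a `1`-connected space `X` of `R`-finite type together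
with its (designated) cochain algebra `C = C^*(X;R)` and loop-space homology. -/
structure SimplyConnectedSpaceData : Type (u + 1) where
  X : Type u
  [topX : TopologicalSpace X]
  x₀ : X
  [pconn : PathConnectedSpace X]
  [sconn : SimplyConnectedSpace X]
  /-- the loop-space homology `H_n(ΩX;R)` -/
  LH : ℕ → Type u
  [lhAdd : ∀ n, AddCommGroup (LH n)]
  [lhMod : ∀ n, Module R (LH n)]
  /-- the cochain algebra `C^*(X;R)` -/
  C : GradedDGA R
  /-- `H^0(X;R) = R` -/
  H0 : Nonempty (cohomology C.diff 0 ≃ₗ[R] R)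
  /-- `H^1(X;R) = 0` -/
  H1 : Subsingleton (cohomology C.diff 1)
  /-- each `H^i(X;R)` is a finite type `R`-module -/
  Hfg : ∀ i : ℕ, Module.Finite R (cohomology C.diff i)

attribute [instance] SimplyConnectedSpaceData.topX SimplyConnectedSpaceData.pconn
  SimplyConnectedSpaceData.sconn SimplyConnectedSpaceData.lhAdd
  SimplyConnectedSpaceData.lhMod

end Spaces

section PID

/-- A submodule of a free module over a principal ideal domain is free, in arbitrary rank. -/
theorem free_submodule_finsupp {R : Type*} [CommRing R] [IsDomain R] [IsPrincipalIdealRing R]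
    {ι : Type*} (N : Submodule R (ι →₀ R)) : Module.Free R N := by
  classical
  obtain ⟨lo, wf⟩ := exists_wellFoundedLT ι
  let F : ι → Submodule R (ι →₀ R) := fun i =>
    { carrier := {x | x ∈ N ∧ ∀ j, i < j → x j = 0}
      zero_mem' := ⟨N.zero_mem, fun _ _ => rfl⟩
      add_mem' := fun {x y} hx hy => ⟨N.add_mem hx.1 hy.1, fun j hj => by
        rw [Finsupp.add_apply, hx.2 j hj, hy.2 j hj, add_zero]⟩
      smul_mem' := fun c x hx => ⟨N.smul_mem c hx.1, fun j hj => by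
        rw [Finsupp.smul_apply, hx.2 j hj, smul_zero]⟩ }
  have hgen : ∀ i, ∃ x ∈ F i, ∀ y ∈ F i, ∃ c : R, y i = c * x i := by
    intro i
    obtain ⟨a, ha⟩ := IsPrincipalIdealRing.principal
      (Submodule.map (Finsupp.lapply (R := R) i) (F i))
    have ha' : a ∈ Submodule.map (Finsupp.lapply (R := R) i) (F i) := by
      rw [ha]; exact Submodule.mem_span_singleton_self a
    obtain ⟨x, hx, rfl⟩ := ha'
    refine ⟨x, hx, fun y hy => ?_⟩
    have : y i ∈ Submodule.map (Finsupp.lapply (R := R) i) (F i) := ⟨y, hy, rfl⟩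
    rw [ha] at this
    obtain ⟨c, hc⟩ := Submodule.mem_span_singleton.1 this
    exact ⟨c, hc.symm⟩
  choose x hxF hx using hgen
  let J := {i // x i i ≠ 0}
  let v : J → N := fun i => ⟨x i, (hxF i).1⟩
  have hli : LinearIndependent R v := by
    refine LinearIndependent.of_comp N.subtype ?_
    rw [linearIndependent_iff]
    intro l hl
    by_contra hne
    have hs : l.support.Nonempty := Finsupp.support_nonempty_iff.2 hne
    let m := l.support.max' hs
    have hm : m ∈ l.support := l.support.max'_mem hs
    have h1 : Finsupp.linearCombination R (N.subtype ∘ v) l m.1 = 0 := by rw [hl]; rfl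
    rw [Finsupp.linearCombination_apply, Finsupp.sum,
      Finsupp.finsetSum_apply, Finset.sum_eq_single m] at h1
    · have : l m * x m m = 0 := h1
      rcases mul_eq_zero.1 this with h | h
      · exact Finsupp.mem_support_iff.1 hm h
      · exact m.2 h
    · intro b hb hbm
      have hlt : b < m := lt_of_le_of_ne (l.support.le_max' b hb) hbm
      have : x b m = 0 := (hxF b).2 m hlt
      show l b * x b m = 0
      rw [this, mul_zero]
    · intro h; exact absurd hm h
  have hspan : ∀ i, ∀ y (hy : y ∈ F i), (⟨y, hy.1⟩ : N) ∈ Submodule.span R (Set.range v) := by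
    intro i
    induction i using wf.induction with
    | _ i ih =>
      intro y hy
      obtain ⟨c, hc⟩ := hx i y hy
      have key : ∀ z (hz : z ∈ F i), z i = 0 →
          (⟨z, hz.1⟩ : N) ∈ Submodule.span R (Set.range v) := by
        intro z hz hzi
        by_cases h0 : z = 0
        · subst h0; exact Submodule.zero_mem _
        · have hs : z.support.Nonempty := Finsupp.support_nonempty_iff.2 h0
          have hm := z.support.max'_mem hs
          have hlt : z.support.max' hs < i := by
            by_contra hcon
            rcases eq_or_lt_of_le (not_lt.1 hcon) with h | h
            · rw [← h] at hm; exact Finsupp.mem_support_iff.1 hm hzi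
            · exact Finsupp.mem_support_iff.1 hm (hz.2 _ h)
          refine ih _ hlt z ⟨hz.1, fun j hj => ?_⟩
          by_contra hcon
          exact absurd (z.support.le_max' j (Finsupp.mem_support_iff.2 hcon)) (not_le.2 hj)
      by_cases hxi : x i i = 0
      · exact key y hy (by rw [hc, hxi, mul_zero])
      · have hz : y - c • x i ∈ F i := (F i).sub_mem hy ((F i).smul_mem c (hxF i))
        have h1 := key _ hz (by simp [hc])
        have h2 : c • v ⟨i, hxi⟩ ∈ Submodule.span R (Set.range v) :=
          Submodule.smul_mem _ _ (Submodule.subset_span ⟨_, rfl⟩)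
        have h3 := Submodule.add_mem _ h1 h2
        convert h3 using 1
        ext1
        show y = y - c • x i + c • x i
        abel
  refine Module.Free.of_basis (Module.Basis.mk hli ?_)
  rintro ⟨y, hy⟩ -
  by_cases h0 : y = 0
  · subst h0; exact Submodule.zero_mem _
  · have hs : y.support.Nonempty := Finsupp.support_nonempty_iff.2 h0
    refine hspan (y.support.max' hs) y ⟨hy, fun j hj => ?_⟩
    by_contra hcon
    exact absurd (y.support.le_max' j (Finsupp.mem_support_iff.2 hcon)) (not_le.2 hj)

theorem free_submodule {R : Type*} [CommRing R] [IsDomain R] [IsPrincipalIdealRing R]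
    {M : Type*} [AddCommGroup M] [Module R M] [Module.Free R M] (N : Submodule R M) :
    Module.Free R N := by
  let e := (Module.Free.chooseBasis R M).repr
  have := free_submodule_finsupp (N.map e.toLinearMap)
  exact Module.Free.of_equiv (e.submoduleMap N).symm

end PID

section Scale

variable {R : Type u} [CommRing R] {A : Type u} [Ring A] [Algebra R A]
  (𝒜 : ℕ → Submodule R A) [GradedAlgebra 𝒜]

/-- The algebra endomorphism multiplying degree `i` elements by `c ^ i`. -/
noncomputable def scaleHom (c : R) : A →ₐ[R] A :=
  (DirectSum.toAlgebra R (fun i => 𝒜 i) (fun i => c ^ i • (𝒜 i).subtype)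
    (by simp [GradedMonoid.GOne.one]) (by
      intro i j a b
      show c ^ (i + j) • ((a : A) * (b : A)) = (c ^ i • (a : A)) * (c ^ j • (b : A))
      rw [smul_mul_smul_comm, pow_add])).comp
    (DirectSum.decomposeAlgEquiv 𝒜).toAlgHom

theorem scaleHom_of_mem (c : R) {i : ℕ} {a : A} (ha : a ∈ 𝒜 i) :
    scaleHom 𝒜 c a = c ^ i • a := by
  have : DirectSum.decompose 𝒜 a = DirectSum.of (fun i => 𝒜 i) i ⟨a, ha⟩ :=
    DirectSum.decompose_of_mem 𝒜 ha
  have h2 : (DirectSum.decomposeAlgEquiv 𝒜).toAlgHom a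
      = DirectSum.of (fun i => 𝒜 i) i ⟨a, ha⟩ := this
  rw [scaleHom, AlgHom.comp_apply, h2]
  exact DirectSum.toAddMonoid_of (fun i => (c ^ i • (𝒜 i).subtype).toAddMonoidHom) i ⟨a, ha⟩

/-- Induction on the homogeneous components of an element. -/
theorem homogeneous_induction {P : A → Prop} (hom : ∀ i, ∀ a ∈ 𝒜 i, P a)
    (add : ∀ a b, P a → P b → P (a + b)) (a : A) : P a :=
  DirectSum.Decomposition.inductionOn 𝒜 (hom 0 0 (Submodule.zero_mem _))
    (fun {i} m => hom i m m.2) add a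

theorem scaleHom_mem (c : R) {i : ℕ} {a : A} (ha : a ∈ 𝒜 i) : scaleHom 𝒜 c a ∈ 𝒜 i := by
  rw [scaleHom_of_mem 𝒜 c ha]; exact Submodule.smul_mem _ _ ha

theorem scaleHom_one (a : A) : scaleHom 𝒜 (1 : R) a = a := by
  induction a using homogeneous_induction 𝒜 with
  | hom i a ha => rw [scaleHom_of_mem 𝒜 _ ha, one_pow, one_smul]
  | add a b ha hb => rw [map_add, ha, hb]

theorem scaleHom_scaleHom (c e : R) (a : A) :
    scaleHom 𝒜 c (scaleHom 𝒜 e a) = scaleHom 𝒜 (c * e) a := by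
  induction a using homogeneous_induction 𝒜 with
  | hom i a ha =>
    rw [scaleHom_of_mem 𝒜 e ha, map_smul, scaleHom_of_mem 𝒜 c ha, scaleHom_of_mem 𝒜 _ ha,
      smul_smul, mul_pow, mul_comm]
  | add a b ha hb => simp only [map_add, ha, hb]

theorem scaleHom_map_of_degree_one {F : A →ₗ[R] A} (hF : ∀ i, ∀ a ∈ 𝒜 i, F a ∈ 𝒜 (i + 1))
    (c : R) (a : A) : scaleHom 𝒜 c (F a) = c • F (scaleHom 𝒜 c a) := by
  induction a using homogeneous_induction 𝒜 with
  | hom i a ha =>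
    rw [scaleHom_of_mem 𝒜 c ha, map_smul, scaleHom_of_mem 𝒜 c (hF i a ha), smul_smul, pow_succ']
  | add a b ha hb => simp only [map_add, ha, hb, smul_add]

variable {𝒜} (D : Differential R 𝒜)

theorem Differential.d_scale (c : R) (a : A) :
    scaleHom 𝒜 c (D.d a) = c • D.d (scaleHom 𝒜 c a) :=
  scaleHom_map_of_degree_one 𝒜 D.d_degree c a

theorem neg_one_zpow_smul {M : Type*} [AddCommGroup M] [Module R M] (i : ℕ) (m : M) :
    ((-1 : ℤ) ^ i) • m = ((-1 : R) ^ i) • m := by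
  rcases neg_one_pow_eq_or ℤ i with h | h <;> rcases Nat.even_or_odd i with h' | h' <;>
    simp [h'.neg_one_pow]

theorem Differential.d_mul (a b : A) :
    D.d (a * b) = D.d a * b + scaleHom 𝒜 (-1) a * D.d b := by
  induction a using homogeneous_induction 𝒜 with
  | hom i a ha =>
    induction b using homogeneous_induction 𝒜 with
    | hom j b hb =>
      rw [D.leibniz i j a ha b hb, scaleHom_of_mem 𝒜 _ ha, neg_one_zpow_smul (R := R),
        smul_mul_assoc]
    | add b c hb hc => rw [mul_add, map_add, map_add, hb, hc, mul_add, mul_add]; abel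
  | add a c ha hc => rw [add_mul, map_add, map_add, map_add, ha, hc, add_mul, add_mul]; abel

theorem Differential.d_one : D.d 1 = 0 := by
  have h := D.d_mul 1 1
  rw [mul_one, map_one (scaleHom 𝒜 (-1 : R)), one_mul, mul_one] at h
  simpa using h

end Scale

section FreeExt

/-- The relations making `A → FreeAlgebra R (A ⊕ S)` an algebra morphism. -/
inductive FreeExt.Rel (R : Type u) [CommRing R] (A : Type u) [Ring A] [Algebra R A]
    (S : Type u) : FreeAlgebra R (A ⊕ S) → FreeAlgebra R (A ⊕ S) → Prop
  | add (a b : A) : FreeExt.Rel R A S (FreeAlgebra.ι R (Sum.inl (a + b)))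
      (FreeAlgebra.ι R (Sum.inl a) + FreeAlgebra.ι R (Sum.inl b))
  | mul (a b : A) : FreeExt.Rel R A S (FreeAlgebra.ι R (Sum.inl (a * b)))
      (FreeAlgebra.ι R (Sum.inl a) * FreeAlgebra.ι R (Sum.inl b))
  | scalar (r : R) : FreeExt.Rel R A S (FreeAlgebra.ι R (Sum.inl (algebraMap R A r)))
      (algebraMap R _ r)

/-- The free product of the algebra `A` with the free algebra on the set `S`. -/
def FreeExt (R : Type u) [CommRing R] (A : Type u) [Ring A] [Algebra R A] (S : Type u) :
    Type u :=
  RingQuot (FreeExt.Rel R A S)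

variable {R : Type u} [CommRing R] {A : Type u} [Ring A] [Algebra R A] {S : Type u}

noncomputable instance : Ring (FreeExt R A S) := inferInstanceAs (Ring (RingQuot _))
noncomputable instance : Algebra R (FreeExt R A S) := inferInstanceAs (Algebra R (RingQuot _))

namespace FreeExt

/-- The quotient map from the free algebra. -/
noncomputable def mk : FreeAlgebra R (A ⊕ S) →ₐ[R] FreeExt R A S :=
  RingQuot.mkAlgHom R (Rel R A S)

theorem mk_rel {x y : FreeAlgebra R (A ⊕ S)} (h : Rel R A S x y) :
    (mk x : FreeExt R A S) = mk y :=
  RingQuot.mkAlgHom_rel R h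

/-- The inclusion of `A`. -/
noncomputable def inl : A →ₐ[R] FreeExt R A S :=
  AlgHom.ofLinearMap
    { toFun := fun a => mk (FreeAlgebra.ι R (Sum.inl a))
      map_add' := fun a b => by rw [mk_rel (.add a b), map_add]
      map_smul' := fun r a => by
        rw [Algebra.smul_def, mk_rel (.mul _ a), map_mul, mk_rel (.scalar r), AlgHom.commutes,
          RingHom.id_apply, Algebra.smul_def] }
    (by
      show mk (FreeAlgebra.ι R (Sum.inl (1 : A))) = 1
      rw [← map_one (algebraMap R A), mk_rel (.scalar 1), map_one, map_one])
    (fun a b => by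
      show mk (FreeAlgebra.ι R (Sum.inl (a * b))) = _
      rw [mk_rel (.mul a b), map_mul]; rfl)

/-- The generators. -/
noncomputable def gen (s : S) : FreeExt R A S := mk (FreeAlgebra.ι R (Sum.inr s))

/-- The universal property. -/
noncomputable def lift {C : Type*} [Ring C] [Algebra R C] (g : A →ₐ[R] C) (h : S → C) :
    FreeExt R A S →ₐ[R] C :=
  RingQuot.liftAlgHom R ⟨FreeAlgebra.lift R (Sum.elim g h), by
    intro x y hxy
    cases hxy <;> simp⟩

@[simp] theorem lift_inl {C : Type*} [Ring C] [Algebra R C] (g : A →ₐ[R] C) (h : S → C)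
    (a : A) : lift g h (inl a : FreeExt R A S) = g a := by
  show RingQuot.liftAlgHom R _ (RingQuot.mkAlgHom R _ _) = _
  rw [RingQuot.liftAlgHom_mkAlgHom_apply]
  simp

@[simp] theorem lift_gen {C : Type*} [Ring C] [Algebra R C] (g : A →ₐ[R] C) (h : S → C)
    (s : S) : lift g h (gen s : FreeExt R A S) = h s := by
  show RingQuot.liftAlgHom R _ (RingQuot.mkAlgHom R _ _) = _
  rw [RingQuot.liftAlgHom_mkAlgHom_apply]
  simp

theorem hom_ext {C : Type*} [Ring C] [Algebra R C] {φ ψ : FreeExt R A S →ₐ[R] C}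
    (h1 : ∀ a, φ (inl a) = ψ (inl a)) (h2 : ∀ s, φ (gen s) = ψ (gen s)) : φ = ψ := by
  apply RingQuot.ringQuot_ext'
  apply FreeAlgebra.hom_ext
  funext x
  rcases x with a | s
  · exact h1 a
  · exact h2 s

theorem induction {P : FreeExt R A S → Prop} (h_inl : ∀ a, P (inl a)) (h_gen : ∀ s, P (gen s))
    (add : ∀ x y, P x → P y → P (x + y)) (mul : ∀ x y, P x → P y → P (x * y))
    (x : FreeExt R A S) : P x := by
  let T : Subalgebra R (FreeExt R A S) :=
    { carrier := {x | P x}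
      mul_mem' := fun {a b} ha hb => mul a b ha hb
      add_mem' := fun {a b} ha hb => add a b ha hb
      algebraMap_mem' := fun r => by
        show P _
        rw [← AlgHom.commutes inl]
        exact h_inl _ }
  let φ : FreeExt R A S →ₐ[R] T :=
    lift (inl.codRestrict T h_inl) (fun s => ⟨gen s, h_gen s⟩)
  have : T.val.comp φ = AlgHom.id R _ :=
    hom_ext (fun a => by simp [φ]) (fun s => by simp [φ])
  have h := DFunLike.congr_fun this x
  have h2 : ((φ x : T) : FreeExt R A S) = x := h
  rw [← h2]
  exact (φ x).2

section Grading

variable (𝒜 : ℕ → Submodule R A) (deg : S → ℕ)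

/-- Homogeneous elements of the free extension. -/
inductive IsHomog : ℕ → FreeExt R A S → Prop
  | inl (n : ℕ) (a : A) (ha : a ∈ 𝒜 n) : IsHomog n (inl a)
  | gen (s : S) : IsHomog (deg s) (gen s)
  | add (n : ℕ) (x y : FreeExt R A S) : IsHomog n x → IsHomog n y → IsHomog n (x + y)
  | smul (n : ℕ) (r : R) (x : FreeExt R A S) : IsHomog n x → IsHomog n (r • x)
  | mul (i j : ℕ) (x y : FreeExt R A S) : IsHomog i x → IsHomog j y → IsHomog (i + j) (x * y)

/-- The grading of the free extension. -/
def grading (n : ℕ) : Submodule R (FreeExt R A S) where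
  carrier := {x | IsHomog 𝒜 deg n x}
  zero_mem' := by
    have := IsHomog.inl (deg := deg) n (0 : A) (𝒜 n).zero_mem
    rwa [map_zero] at this
  add_mem' := fun hx hy => IsHomog.add _ _ _ hx hy
  smul_mem' := fun r _ hx => IsHomog.smul _ r _ hx

variable {𝒜 deg}

theorem inl_mem {n : ℕ} {a : A} (ha : a ∈ 𝒜 n) :
    (inl a : FreeExt R A S) ∈ grading 𝒜 deg n := IsHomog.inl n a ha

theorem gen_mem (s : S) : (gen s : FreeExt R A S) ∈ grading 𝒜 deg (deg s) := IsHomog.gen s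

variable [GradedAlgebra 𝒜]

instance : SetLike.GradedMonoid (grading (S := S) 𝒜 deg) where
  one_mem := by
    rw [← map_one inl]; exact inl_mem (SetLike.one_mem_graded 𝒜)
  mul_mem := fun _ _ _ _ hx hy => IsHomog.mul _ _ _ _ hx hy

variable (𝒜 deg) in
/-- The decomposition of elements of `A` inside the free extension. -/
noncomputable def decomposeInl : A →ₐ[R] DirectSum ℕ fun i => grading (S := S) 𝒜 deg i :=
  (DirectSum.toAlgebra R (fun i => 𝒜 i)
    (fun i => (DirectSum.lof R ℕ (fun i => grading (S := S) 𝒜 deg i) i).comp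
      (((inl (S := S)).toLinearMap.restrict (p := 𝒜 i) (q := grading 𝒜 deg i)
        (fun _ ha => inl_mem ha))))
    (by
      show DirectSum.of (fun i => grading (S := S) 𝒜 deg i) 0 _ = 1
      rw [DirectSum.one_def]
      congr 1
      ext1
      exact map_one inl)
    (by
      intro i j a b
      show DirectSum.of (fun i => grading (S := S) 𝒜 deg i) (i + j) _ =
        DirectSum.of (fun i => grading (S := S) 𝒜 deg i) i _ *
        DirectSum.of (fun i => grading (S := S) 𝒜 deg i) j _
      rw [DirectSum.of_mul_of]
      congr 1
      ext1
      exact map_mul inl (a : A) (b : A))).comp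
    (DirectSum.decomposeAlgEquiv 𝒜).toAlgHom

theorem decomposeInl_of_mem {i : ℕ} {a : A} (ha : a ∈ 𝒜 i) :
    decomposeInl (S := S) 𝒜 deg a = DirectSum.of _ i ⟨inl a, inl_mem ha⟩ := by
  have h2 : (DirectSum.decomposeAlgEquiv 𝒜).toAlgHom a
      = DirectSum.of (fun i => 𝒜 i) i ⟨a, ha⟩ := DirectSum.decompose_of_mem 𝒜 ha
  rw [decomposeInl, AlgHom.comp_apply, h2]
  exact DirectSum.toAddMonoid_of (fun i =>
    ((DirectSum.lof R ℕ (fun i => grading (S := S) 𝒜 deg i) i).comp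
      (((inl (S := S)).toLinearMap.restrict (p := 𝒜 i) (q := grading 𝒜 deg i)
        (fun _ ha => inl_mem ha)))).toAddMonoidHom) i ⟨a, ha⟩

variable (𝒜 deg) in
/-- The decomposition map. -/
noncomputable def decomposeHom :
    FreeExt R A S →ₐ[R] DirectSum ℕ fun i => grading (S := S) 𝒜 deg i :=
  lift (decomposeInl 𝒜 deg) (fun s => DirectSum.of (fun i => grading (S := S) 𝒜 deg i)
    (deg s) ⟨gen s, gen_mem s⟩)

theorem decomposeHom_of_mem {i : ℕ} {x : FreeExt R A S} (hx : IsHomog 𝒜 deg i x) :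
    decomposeHom 𝒜 deg x = DirectSum.of (fun i => grading (S := S) 𝒜 deg i) i ⟨x, hx⟩ := by
  induction hx with
  | inl n a ha => rw [decomposeHom, lift_inl, decomposeInl_of_mem ha]
  | gen s => rw [decomposeHom, lift_gen]
  | add n x y hx hy ihx ihy => rw [map_add, ihx, ihy, ← map_add]; rfl
  | smul n r x hx ih =>
    rw [map_smul, ih]
    exact (map_smul (DirectSum.lof R ℕ (fun i => grading (S := S) 𝒜 deg i) n) r ⟨x, hx⟩).symm
  | mul i j x y hx hy ihx ihy => rw [map_mul, ihx, ihy, DirectSum.of_mul_of]; rfl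

noncomputable instance : GradedAlgebra (grading (S := S) 𝒜 deg) :=
  GradedAlgebra.ofAlgHom _ (decomposeHom 𝒜 deg)
    (by
      apply hom_ext
      · intro a
        induction a using homogeneous_induction 𝒜 with
        | hom i a ha =>
          rw [AlgHom.comp_apply, decomposeHom_of_mem (.inl i a ha)]
          exact DirectSum.coeAddMonoidHom_of _ i _
        | add a b ha hb => rw [map_add, map_add, map_add, ha, hb]
      · intro s
        rw [AlgHom.comp_apply, decomposeHom_of_mem (.gen s)]
        exact DirectSum.coeAddMonoidHom_of _ _ _)
    (fun i x => decomposeHom_of_mem x.2)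

end Grading

section Derivation

variable {Q : Type*} [Ring Q] [Algebra R Q]
  (α β : FreeExt R A S →ₐ[R] Q) (δ : A →ₗ[R] Q)
  (hδ : ∀ a b, δ (a * b) = α (inl a) * δ b + δ a * β (inl b)) (δS : S → Q)

/-- The triangular algebra morphism encoding a twisted derivation. -/
noncomputable def derInl : A →ₐ[R] Matrix (Fin 2) (Fin 2) Q :=
  AlgHom.ofLinearMap
    { toFun := fun a => !![α (inl a), δ a; 0, β (inl a)]
      map_add' := fun a b => by ext i j; fin_cases i <;> fin_cases j <;> simp
      map_smul' := fun r a => by ext i j; fin_cases i <;> fin_cases j <;> simp }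
    (by
      have h := hδ 1 1
      simp only [mul_one, map_one, one_mul] at h
      have h1 : δ 1 = 0 := by simpa using h
      ext i j; fin_cases i <;> fin_cases j <;> simp [h1])
    (fun a b => by ext i j; fin_cases i <;> fin_cases j <;> simp [Matrix.mul_apply, hδ])

/-- The triangular algebra morphism on the free extension. -/
noncomputable def derHom : FreeExt R A S →ₐ[R] Matrix (Fin 2) (Fin 2) Q :=
  lift (derInl α β δ hδ) (fun s => !![α (gen s), δS s; 0, β (gen s)])

theorem derHom_entries (x : FreeExt R A S) :
    derHom α β δ hδ δS x 0 0 = α x ∧ derHom α β δ hδ δS x 1 0 = 0 ∧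
    derHom α β δ hδ δS x 1 1 = β x := by
  induction x using FreeExt.induction with
  | h_inl a => simp [derHom, derInl]
  | h_gen s => simp [derHom]
  | add x y hx hy => simp [hx, hy]
  | mul x y hx hy => simp [Matrix.mul_apply, hx, hy]

/-- The `(α, β)`-derivation with prescribed values on `A` and on the generators. -/
noncomputable def der : FreeExt R A S →ₗ[R] Q where
  toFun x := derHom α β δ hδ δS x 0 1
  map_add' x y := by simp
  map_smul' r x := by simp

@[simp] theorem der_inl (a : A) : der α β δ hδ δS (inl a) = δ a := by
  simp [der, derHom, derInl]

@[simp] theorem der_gen (s : S) : der α β δ hδ δS (gen s) = δS s := by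
  simp [der, derHom]

theorem der_mul (x y : FreeExt R A S) :
    der α β δ hδ δS (x * y) = α x * der α β δ hδ δS y + der α β δ hδ δS x * β y := by
  have hx := derHom_entries α β δ hδ δS x
  have hy := derHom_entries α β δ hδ δS y
  simp [der, Matrix.mul_apply, hx, hy]

end Derivation

end FreeExt
end FreeExt

open scoped TensorProduct

section TensorSquare

variable {R : Type u} [CommRing R] {X : Type u} [Ring X] [Algebra R X]
  {𝒳 : ℕ → Submodule R X} [GradedAlgebra 𝒳] (D : Differential R 𝒳)

/-- The differential on the tensor square. -/
noncomputable def tensorD : X ⊗[R] X →ₗ[R] X ⊗[R] X :=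
  TensorProduct.map D.d LinearMap.id + TensorProduct.map (scaleHom 𝒳 (-1)).toLinearMap D.d

@[simp] theorem tensorD_tmul (a b : X) :
    tensorD D (a ⊗ₜ b) = D.d a ⊗ₜ b + scaleHom 𝒳 (-1) a ⊗ₜ D.d b := rfl

variable (𝒳) in
/-- The sign automorphism of the tensor square. -/
noncomputable def tensorScale (c : R) : X ⊗[R] X →ₐ[R] X ⊗[R] X :=
  Algebra.TensorProduct.map (scaleHom 𝒳 c) (scaleHom 𝒳 c)

@[simp] theorem tensorScale_tmul (c : R) (a b : X) :
    tensorScale 𝒳 c (a ⊗ₜ b) = scaleHom 𝒳 c a ⊗ₜ scaleHom 𝒳 c b := rfl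

theorem tensorD_mul_right (m : X ⊗[R] X) (y : X) :
    tensorD D (m * (1 ⊗ₜ y)) =
      tensorD D m * (1 ⊗ₜ y) + tensorScale 𝒳 (-1) m * (1 ⊗ₜ D.d y) := by
  induction m using TensorProduct.induction_on with
  | zero => simp
  | tmul a b =>
    simp [D.d_mul, add_mul, TensorProduct.tmul_add, add_assoc]
  | add m n hm hn => rw [add_mul, map_add, map_add, map_add, hm, hn, add_mul, add_mul]; abel

theorem tensorD_mul_left (x : X) (m : X ⊗[R] X) :
    tensorD D ((x ⊗ₜ 1) * m) =
      (D.d x ⊗ₜ 1) * m + (scaleHom 𝒳 (-1) x ⊗ₜ 1) * tensorD D m := by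
  induction m using TensorProduct.induction_on with
  | zero => simp
  | tmul a b =>
    simp [D.d_mul, mul_add, TensorProduct.add_tmul]
    abel
  | add m n hm hn => rw [mul_add, map_add, map_add, hm, hn, mul_add, mul_add]; abel

variable (𝒳) in
/-- The part of degree `n - k` of the tensor square (zero if `n < k`). -/
def tensorGr (n k : ℕ) : Submodule R (X ⊗[R] X) :=
  Submodule.span R {z | ∃ i j, i + j + k = n ∧ ∃ a ∈ 𝒳 i, ∃ b ∈ 𝒳 j, z = a ⊗ₜ b}

theorem tmul_mem_tensorGr {n k i j : ℕ} (h : i + j + k = n) {a b : X} (ha : a ∈ 𝒳 i)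
    (hb : b ∈ 𝒳 j) : (a ⊗ₜ[R] b) ∈ tensorGr 𝒳 n k :=
  Submodule.subset_span ⟨i, j, h, a, ha, b, hb, rfl⟩

theorem tensorGr_induction {n k : ℕ} {P : X ⊗[R] X → Prop} (zero : P 0)
    (add : ∀ x y, P x → P y → P (x + y)) (smul : ∀ (r : R) x, P x → P (r • x))
    (tmul : ∀ i j, i + j + k = n → ∀ a ∈ 𝒳 i, ∀ b ∈ 𝒳 j, P (a ⊗ₜ b))
    {y : X ⊗[R] X} (hy : y ∈ tensorGr 𝒳 n k) : P y := by
  induction hy using Submodule.span_induction with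
  | mem x h => obtain ⟨i, j, h, a, ha, b, hb, rfl⟩ := h; exact tmul i j h a ha b hb
  | zero => exact zero
  | add x y _ _ hx hy => exact add x y hx hy
  | smul r x _ hx => exact smul r x hx

theorem eqOn_tensorGr {n k : ℕ} {M : Type*} [AddCommGroup M] [Module R M]
    {F G : X ⊗[R] X →ₗ[R] M}
    (tmul : ∀ i j, i + j + k = n → ∀ a ∈ 𝒳 i, ∀ b ∈ 𝒳 j, F (a ⊗ₜ b) = G (a ⊗ₜ b))
    {y : X ⊗[R] X} (hy : y ∈ tensorGr 𝒳 n k) : F y = G y := by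
  refine tensorGr_induction (P := fun y => F y = G y) (by simp) ?_ ?_ tmul hy
  · intro x y hx hy
    rw [map_add, map_add, hx, hy]
  · intro r x hx
    rw [map_smul, map_smul, hx]

theorem map_tensorGr_mem {n k : ℕ} {M : Type*} [AddCommGroup M] [Module R M]
    {F : X ⊗[R] X →ₗ[R] M} {N : Submodule R M}
    (tmul : ∀ i j, i + j + k = n → ∀ a ∈ 𝒳 i, ∀ b ∈ 𝒳 j, F (a ⊗ₜ b) ∈ N)
    {y : X ⊗[R] X} (hy : y ∈ tensorGr 𝒳 n k) : F y ∈ N := by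
  refine tensorGr_induction (P := fun y => F y ∈ N) (by simp) ?_ ?_ tmul hy
  · intro x y hx hy
    rw [map_add]
    exact N.add_mem hx hy
  · intro r x hx
    rw [map_smul]
    exact N.smul_mem r hx

theorem tensorScale_of_mem (c : R) {n k : ℕ} {y : X ⊗[R] X} (hy : y ∈ tensorGr 𝒳 n k) :
    c ^ k • tensorScale 𝒳 c y = c ^ n • y := by
  refine eqOn_tensorGr (F := c ^ k • (tensorScale 𝒳 c).toLinearMap)
    (G := c ^ n • LinearMap.id) ?_ hy
  rintro i j rfl a ha b hb
  simp only [LinearMap.smul_apply, AlgHom.toLinearMap_apply, tensorScale_tmul,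
    scaleHom_of_mem 𝒳 c ha, scaleHom_of_mem 𝒳 c hb, TensorProduct.smul_tmul',
    TensorProduct.tmul_smul, LinearMap.id_apply, smul_smul]
  ring_nf

theorem eq_zero_of_mem_tensorGr {n k : ℕ} (h : n < k) {y : X ⊗[R] X}
    (hy : y ∈ tensorGr 𝒳 n k) : y = 0 :=
  eqOn_tensorGr (F := LinearMap.id) (G := 0) (fun _ _ hij => absurd hij (by omega)) hy

theorem mul_left_mem_tensorGr {i n k : ℕ} {x : X} (hx : x ∈ 𝒳 i) {m : X ⊗[R] X}
    (hm : m ∈ tensorGr 𝒳 n k) : (x ⊗ₜ 1) * m ∈ tensorGr 𝒳 (i + n) k := by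
  refine map_tensorGr_mem (F := LinearMap.mulLeft R (x ⊗ₜ[R] (1 : X))) ?_ hm
  intro p q h a ha b hb
  rw [LinearMap.mulLeft_apply, Algebra.TensorProduct.tmul_mul_tmul, one_mul]
  exact tmul_mem_tensorGr (by omega) (SetLike.mul_mem_graded hx ha) hb

theorem mul_right_mem_tensorGr {j n k : ℕ} {y : X} (hy : y ∈ 𝒳 j) {m : X ⊗[R] X}
    (hm : m ∈ tensorGr 𝒳 n k) : m * (1 ⊗ₜ y) ∈ tensorGr 𝒳 (n + j) k := by
  refine map_tensorGr_mem (F := LinearMap.mulRight R ((1 : X) ⊗ₜ[R] y)) ?_ hm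
  intro p q h a ha b hb
  rw [LinearMap.mulRight_apply, Algebra.TensorProduct.tmul_mul_tmul, mul_one]
  exact tmul_mem_tensorGr (by omega) ha (SetLike.mul_mem_graded hb hy)

/-- A contraction in low degrees: `h` is a partial homotopy from the identity to the
augmentation `ε`, and the degree zero part is a retract of the free module `A`. -/
structure LowContraction (D : Differential R 𝒳) (A : Type u) [AddCommGroup A] [Module R A] where
  h : X →ₗ[R] X
  ε : X →ₗ[R] R
  i : A →ₗ[R] X
  r : X →ₗ[R] A
  h_mem : ∀ x ∈ 𝒳 1, h x ∈ 𝒳 0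
  h_zero : ∀ n, n ≠ 1 → ∀ x ∈ 𝒳 n, h x = 0
  ε_zero : ∀ n, n ≠ 0 → ∀ x ∈ 𝒳 n, ε x = 0
  r_zero : ∀ n, n ≠ 0 → ∀ x ∈ 𝒳 n, r x = 0
  ir : ∀ x ∈ 𝒳 0, i (r x) = x
  h_d : ∀ x ∈ 𝒳 0, h (D.d x) = x - ε x • 1
  ε_one : ε 1 = 1

variable {D} {A : Type u} [AddCommGroup A] [Module R A] (C : LowContraction D A)

/-- The augmentation of the tensor square. -/
noncomputable def LowContraction.aug : X ⊗[R] X →ₗ[R] R :=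
  (TensorProduct.lid R R).toLinearMap ∘ₗ TensorProduct.map C.ε C.ε

@[simp] theorem LowContraction.aug_tmul (a b : X) : C.aug (a ⊗ₜ b) = C.ε a * C.ε b := rfl

/-- The augmentation as an endomorphism. -/
noncomputable def LowContraction.εX : X →ₗ[R] X := (LinearMap.toSpanSingleton R X 1) ∘ₗ C.ε

@[simp] theorem LowContraction.εX_apply (a : X) : C.εX a = C.ε a • 1 := rfl

theorem LowContraction.eq_aug_of_tensorD_eq_zero {n k : ℕ} (hn : n = k) {y : X ⊗[R] X}
    (hy : y ∈ tensorGr 𝒳 n k) (hD : tensorD D y = 0) : y = C.aug y • (1 ⊗ₜ 1) := by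
  have h1 : TensorProduct.map C.h LinearMap.id (tensorD D y) =
      y - TensorProduct.map C.εX LinearMap.id y := by
    refine eqOn_tensorGr (F := TensorProduct.map C.h LinearMap.id ∘ₗ tensorD D)
      (G := LinearMap.id - TensorProduct.map C.εX LinearMap.id) ?_ hy
    intro i j hij a ha b hb
    obtain rfl : i = 0 := by omega
    simp [C.h_d a ha, TensorProduct.sub_tmul, C.h_zero 0 (by simp) _ (scaleHom_mem 𝒳 (-1) ha)]
  have h2 : TensorProduct.map LinearMap.id C.h (tensorD D y) =
      y - TensorProduct.map LinearMap.id C.εX y := by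
    refine eqOn_tensorGr (F := TensorProduct.map LinearMap.id C.h ∘ₗ tensorD D)
      (G := LinearMap.id - TensorProduct.map LinearMap.id C.εX) ?_ hy
    intro i j hij a ha b hb
    obtain rfl : i = 0 := by omega
    obtain rfl : j = 0 := by omega
    simp [C.h_d b hb, TensorProduct.tmul_sub, C.h_zero 0 (by simp) _ hb,
      scaleHom_of_mem 𝒳 _ ha]
  rw [hD, map_zero, eq_comm, sub_eq_zero] at h1 h2
  have h3 : ∀ z : X ⊗[R] X, TensorProduct.map C.εX LinearMap.id
      (TensorProduct.map LinearMap.id C.εX z) = C.aug z • (1 ⊗ₜ 1) := by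
    intro z
    induction z using TensorProduct.induction_on with
    | zero => simp
    | tmul a b => simp [TensorProduct.smul_tmul', TensorProduct.tmul_smul, smul_smul, mul_comm]
    | add z w hz hw => simp only [map_add, hz, hw, add_smul]
  rw [← h3, ← h2, ← h1]

variable (D) in
theorem eq_zero_of_map_coord [Module.Free R A] (w : X ⊗[R] A)
    (h : ∀ c : A →ₗ[R] R, TensorProduct.map LinearMap.id c w = (0 : X ⊗[R] R)) : w = 0 := by
  let b := Module.Free.chooseBasis R A
  apply (TensorProduct.equivFinsuppOfBasisRight (M := X) b).injective
  rw [map_zero]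
  ext i
  have := congrArg (TensorProduct.rid R X) (h (b.coord i))
  rw [map_zero] at this
  rw [Finsupp.zero_apply, ← this]
  clear this h
  induction w using TensorProduct.induction_on with
  | zero => simp
  | tmul a c => simp
  | add z w hz hw => simp [hz, hw]

/-- The contracted left coordinate. -/
noncomputable def LowContraction.left : X ⊗[R] X →ₗ[R] X :=
  (TensorProduct.lid R X).toLinearMap ∘ₗ TensorProduct.map C.ε LinearMap.id

@[simp] theorem LowContraction.left_tmul (a b : X) : C.left (a ⊗ₜ b) = C.ε a • b := rfl

/-- The contraction of the right coordinate with a functional on `A`. -/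
noncomputable def LowContraction.right (c : A →ₗ[R] R) : X ⊗[R] X →ₗ[R] X :=
  (TensorProduct.rid R X).toLinearMap ∘ₗ TensorProduct.map LinearMap.id (c ∘ₗ C.r)

@[simp] theorem LowContraction.right_tmul (c : A →ₗ[R] R) (a b : X) :
    C.right c (a ⊗ₜ b) = c (C.r b) • a := rfl

/-- The difference between the identity and the homotopy. -/
noncomputable def LowContraction.P : X →ₗ[R] X := LinearMap.id - D.d ∘ₗ C.h

theorem LowContraction.P_apply (x : X) : C.P x = x - D.d (C.h x) := rfl

/-- The contracting homotopy of the tensor square in degree one. -/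
noncomputable def LowContraction.Z : X ⊗[R] X →ₗ[R] X ⊗[R] X :=
  TensorProduct.map C.h LinearMap.id + TensorProduct.map C.εX C.h

@[simp] theorem LowContraction.Z_tmul (a b : X) :
    C.Z (a ⊗ₜ b) = C.h a ⊗ₜ b + (C.ε a • 1) ⊗ₜ C.h b := rfl

theorem LowContraction.P_eq_zero (hX : ∀ x ∈ 𝒳 1, D.d x = 0 → ∃ y ∈ 𝒳 0, D.d y = x) {x : X}
    (hx : x ∈ 𝒳 1) (hd : D.d x = 0) : C.P x = 0 := by
  obtain ⟨y, hy, rfl⟩ := hX x hx hd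
  rw [P_apply, C.h_d y hy, map_sub, map_smul, D.d_one]
  simp

theorem LowContraction.exists_tensorD_eq [Module.Free R A] (C : LowContraction D A)
    (hX : ∀ x ∈ 𝒳 1, D.d x = 0 → ∃ y ∈ 𝒳 0, D.d y = x) {n k : ℕ} (hn : n = k + 1)
    {y : X ⊗[R] X} (hy : y ∈ tensorGr 𝒳 n k) (hD : tensorD D y = 0) :
    ∃ z ∈ tensorGr 𝒳 k k, tensorD D z = y := by
  have cases : ∀ i j, i + j + k = n → i = 0 ∧ j = 1 ∨ i = 1 ∧ j = 0 := by omega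
  have d_one_mem : ∀ {a}, a ∈ 𝒳 0 → D.d a ∈ 𝒳 1 := fun ha => D.d_degree 0 _ ha
  have d_two_mem : ∀ {a}, a ∈ 𝒳 1 → D.d a ∈ 𝒳 2 := fun ha => D.d_degree 1 _ ha
  refine ⟨C.Z y, ?_, ?_⟩
  · refine map_tensorGr_mem (F := C.Z) ?_ hy
    intro i j hij a ha b hb
    rw [Z_tmul]
    rcases cases i j hij with ⟨rfl, rfl⟩ | ⟨rfl, rfl⟩
    · rw [C.h_zero 0 (by simp) a ha, TensorProduct.zero_tmul, zero_add]
      exact tmul_mem_tensorGr (by omega) (Submodule.smul_mem _ _ SetLike.GradedOne.one_mem)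
        (C.h_mem b hb)
    · rw [C.h_zero 0 (by simp) b hb, TensorProduct.tmul_zero, add_zero]
      exact tmul_mem_tensorGr (by omega) (C.h_mem a ha) hb
  · have key : y = tensorD D (C.Z y) + C.Z (tensorD D y) +
        TensorProduct.map C.P (C.i ∘ₗ C.r) y + TensorProduct.map C.εX C.P y := by
      refine eqOn_tensorGr (F := LinearMap.id) (G := tensorD D ∘ₗ C.Z + C.Z ∘ₗ tensorD D +
        TensorProduct.map C.P (C.i ∘ₗ C.r) + TensorProduct.map C.εX C.P) ?_ hy
      intro i j hij a ha b hb
      rcases cases i j hij with ⟨rfl, rfl⟩ | ⟨rfl, rfl⟩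
      · simp [C.h_zero 0 (by simp) a ha, C.h_d a ha, C.ε_zero 1 (by simp) _ (d_one_mem ha),
          scaleHom_of_mem 𝒳 _ ha, C.h_zero 2 (by simp) _ (d_two_mem hb), D.d_one,
          C.r_zero 1 (by simp) b hb, P_apply, TensorProduct.sub_tmul, TensorProduct.tmul_sub]
        abel
      · simp [C.h_zero 0 (by simp) b hb, C.ε_zero 1 (by simp) _ ha,
          scaleHom_of_mem 𝒳 _ ha, scaleHom_of_mem 𝒳 _ (C.h_mem a ha),
          C.h_zero 2 (by simp) _ (d_two_mem ha), C.ε_zero 2 (by simp) _ (d_two_mem ha),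
          C.ir b hb, P_apply, TensorProduct.sub_tmul, TensorProduct.neg_tmul]
    have hleft : C.P (C.left y) = 0 := by
      refine C.P_eq_zero hX ?_ ?_
      · refine map_tensorGr_mem (F := C.left) ?_ hy
        intro i j hij a ha b hb
        rcases cases i j hij with ⟨rfl, rfl⟩ | ⟨rfl, rfl⟩
        · exact Submodule.smul_mem _ _ hb
        · simp [C.ε_zero 1 (by simp) _ ha]
      · rw [← map_zero C.left, ← hD]
        refine eqOn_tensorGr (F := D.d ∘ₗ C.left) (G := C.left ∘ₗ tensorD D) ?_ hy
        intro i j hij a ha b hb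
        rcases cases i j hij with ⟨rfl, rfl⟩ | ⟨rfl, rfl⟩
        · simp [C.ε_zero 1 (by simp) _ (d_one_mem ha), scaleHom_of_mem 𝒳 _ ha]
        · simp [C.ε_zero 1 (by simp) _ ha, C.ε_zero 2 (by simp) _ (d_two_mem ha),
            scaleHom_of_mem 𝒳 _ ha]
    have hright : ∀ c : A →ₗ[R] R, C.P (C.right c y) = 0 := by
      intro c
      refine C.P_eq_zero hX ?_ ?_
      · refine map_tensorGr_mem (F := C.right c) ?_ hy
        intro i j hij a ha b hb
        rcases cases i j hij with ⟨rfl, rfl⟩ | ⟨rfl, rfl⟩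
        · simp [C.r_zero 1 (by simp) _ hb]
        · exact Submodule.smul_mem _ _ ha
      · rw [← map_zero (C.right c), ← hD]
        refine eqOn_tensorGr (F := D.d ∘ₗ C.right c) (G := C.right c ∘ₗ tensorD D) ?_ hy
        intro i j hij a ha b hb
        rcases cases i j hij with ⟨rfl, rfl⟩ | ⟨rfl, rfl⟩
        · simp [C.r_zero 1 (by simp) _ hb, C.r_zero 2 (by simp) _ (d_two_mem hb)]
        · simp [C.r_zero 1 (by simp) _ (d_one_mem hb)]
    have h1 : TensorProduct.map C.εX C.P y = 0 := by
      have : ∀ z, TensorProduct.map C.εX C.P z = 1 ⊗ₜ C.P (C.left z) := by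
        intro z
        induction z using TensorProduct.induction_on with
        | zero => simp
        | tmul a b => simp [TensorProduct.smul_tmul]
        | add z w hz hw => simp only [map_add, hz, hw, TensorProduct.tmul_add]
      rw [this, hleft, TensorProduct.tmul_zero]
    have h2 : TensorProduct.map C.P C.r y = 0 := by
      refine eq_zero_of_map_coord _ fun c => ?_
      have : ∀ z, TensorProduct.map LinearMap.id c (TensorProduct.map C.P C.r z) =
          C.P (C.right c z) ⊗ₜ (1 : R) := by
        intro z
        induction z using TensorProduct.induction_on with
        | zero => simp
        | tmul a b => simp [TensorProduct.smul_tmul]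
        | add z w hz hw => simp only [map_add, hz, hw, TensorProduct.add_tmul]
      rw [this, hright, TensorProduct.zero_tmul]
    have h3 : TensorProduct.map C.P (C.i ∘ₗ C.r) y = 0 := by
      have : TensorProduct.map C.P (C.i ∘ₗ C.r) =
          TensorProduct.map LinearMap.id C.i ∘ₗ TensorProduct.map C.P C.r := by
        rw [← TensorProduct.map_comp, LinearMap.id_comp]
      rw [this, LinearMap.comp_apply, h2, map_zero]
    rw [hD, map_zero, h1, h3, add_zero, add_zero, add_zero] at key
    exact key.symm

end TensorSquare

namespace FreeExt

variable {R : Type u} [CommRing R] {A : Type u} [Ring A] [Algebra R A] {S : Type u}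
  {𝒜 : ℕ → Submodule R A} [GradedAlgebra 𝒜] {deg : S → ℕ}

theorem scaleHom_inl (c : R) (a : A) :
    scaleHom (grading (S := S) 𝒜 deg) c (inl a) = inl (scaleHom 𝒜 c a) := by
  induction a using homogeneous_induction 𝒜 with
  | hom i a ha =>
    rw [scaleHom_of_mem 𝒜 c ha, scaleHom_of_mem _ c (inl_mem ha), map_smul]
  | add a b ha hb => simp only [map_add, ha, hb]

/-- The retraction onto `A` killing the generators. -/
noncomputable def retr : FreeExt R A S →ₐ[R] A := lift (AlgHom.id R A) (fun _ => 0)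

@[simp] theorem retr_inl (a : A) : retr (inl a : FreeExt R A S) = a := by simp [retr]

@[simp] theorem retr_gen (s : S) : retr (gen s : FreeExt R A S) = 0 := by simp [retr]

theorem inl_injective : Function.Injective (inl : A →ₐ[R] FreeExt R A S) :=
  Function.LeftInverse.injective retr_inl

theorem lift_mem {C : Type*} [Ring C] [Algebra R C] {𝒞 : ℕ → Submodule R C}
    [SetLike.GradedMonoid 𝒞] {g : A →ₐ[R] C} {h : S → C}
    (hg : ∀ n, ∀ a ∈ 𝒜 n, g a ∈ 𝒞 n) (hh : ∀ s, h s ∈ 𝒞 (deg s)) {n : ℕ} {x : FreeExt R A S}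
    (hx : x ∈ grading 𝒜 deg n) : lift g h x ∈ 𝒞 n := by
  replace hx : IsHomog 𝒜 deg n x := hx
  induction hx with
  | inl n a ha => rw [lift_inl]; exact hg n a ha
  | gen s => rw [lift_gen]; exact hh s
  | add n x y _ _ hx hy => rw [map_add]; exact Submodule.add_mem _ hx hy
  | smul n r x _ hx => rw [map_smul]; exact Submodule.smul_mem _ _ hx
  | mul i j x y _ _ hx hy => rw [map_mul]; exact SetLike.mul_mem_graded hx hy

theorem retr_mem {n : ℕ} {x : FreeExt R A S} (hx : x ∈ grading 𝒜 deg n) : retr x ∈ 𝒜 n :=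
  lift_mem (fun _ _ h => h) (fun _ => Submodule.zero_mem _) hx

section Differential

variable (D : Differential R 𝒜) (deg) (bd : S → FreeExt R A S)

/-- The derivation of the free extension with prescribed values on the generators. -/
noncomputable def derivation : FreeExt R A S →ₗ[R] FreeExt R A S :=
  der (scaleHom (grading 𝒜 deg) (-1)) (AlgHom.id R _) (inl.toLinearMap ∘ₗ D.d)
    (fun a b => by simp [D.d_mul, scaleHom_inl, add_comm]) bd

theorem derivation_mul (x y : FreeExt R A S) : derivation deg D bd (x * y) =
    scaleHom (grading 𝒜 deg) (-1) x * derivation deg D bd y + derivation deg D bd x * y :=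
  der_mul _ _ _ _ _ _ _

variable {deg} {bd}

theorem derivation_mem (h_deg : ∀ s, bd s ∈ grading 𝒜 deg (deg s + 1)) (n : ℕ) (x : FreeExt R A S) (hx : x ∈ grading 𝒜 deg n) :
    derivation deg D bd x ∈ grading 𝒜 deg (n + 1) := by
  replace hx : IsHomog 𝒜 deg n x := hx
  induction hx with
  | inl n a ha => simp only [derivation, der_inl]; exact inl_mem (D.d_degree n a ha)
  | gen s => simp only [derivation, der_gen]; exact h_deg s
  | add n x y _ _ hx hy => rw [map_add]; exact Submodule.add_mem _ hx hy
  | smul n r x _ hx => rw [map_smul]; exact Submodule.smul_mem _ _ hx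
  | mul i j x y h1 h2 hx hy =>
    rw [derivation_mul]
    refine Submodule.add_mem _ ?_ ?_
    · rw [add_assoc]
      exact SetLike.mul_mem_graded (scaleHom_mem _ _ h1) hy
    · rw [add_right_comm]
      exact SetLike.mul_mem_graded hx h2

variable (h_deg : ∀ s, bd s ∈ grading 𝒜 deg (deg s + 1))

/-- The differential of the free extension with prescribed values on the generators. -/
noncomputable def differential (h_sq : ∀ s, derivation deg D bd (bd s) = 0) :
    Differential R (grading (S := S) 𝒜 deg) where
  d := derivation deg D bd
  d_squared x := by
    induction x using FreeExt.induction with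
    | h_inl a => simp [derivation, D.d_squared]
    | h_gen s => rw [← h_sq s]; simp [derivation]
    | add x y hx hy => rw [map_add, map_add, hx, hy, add_zero]
    | mul x y hx hy =>
      rw [derivation_mul, map_add, derivation_mul, derivation_mul, hx, hy,
        scaleHom_map_of_degree_one _ (derivation_mem D h_deg)]
      simp
  d_degree := derivation_mem D h_deg
  leibniz i j x hx y hy := by
    rw [derivation_mul, scaleHom_of_mem _ _ hx, neg_one_zpow_smul (R := R), smul_mul_assoc,
      add_comm]

variable (h_sq : ∀ s, derivation deg D bd (bd s) = 0)

@[simp] theorem differential_inl (a : A) :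
    (differential D h_deg h_sq).d (inl a) = inl (D.d a) := by
  simp [differential, derivation]

@[simp] theorem differential_gen (s : S) : (differential D h_deg h_sq).d (gen s) = bd s := by
  simp [differential, derivation]

theorem isDGAHom_inl : IsDGAHom D (differential D h_deg h_sq) inl :=
  ⟨fun _ _ h => inl_mem h, fun a => (differential_inl D h_deg h_sq a).symm⟩

theorem isDGAHom_lift {C : Type u} [Ring C] [Algebra R C] {𝒞 : ℕ → Submodule R C}
    [GradedAlgebra 𝒞] (DC : Differential R 𝒞) {g : A →ₐ[R] C} {h : S → C}
    (hg : IsDGAHom D DC g) (hh : ∀ s, h s ∈ 𝒞 (deg s)) (hd : ∀ s, lift g h (bd s) = DC.d (h s)) :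
    IsDGAHom (differential D h_deg h_sq) DC (lift g h) := by
  have hmem : ∀ n, ∀ x ∈ grading 𝒜 deg n, lift g h x ∈ 𝒞 n := fun n x hx =>
    lift_mem hg.map_degree hh hx
  have hscale : ∀ x, lift g h (scaleHom (grading 𝒜 deg) (-1) x) =
      scaleHom 𝒞 (-1) (lift g h x) := by
    intro x
    induction x using homogeneous_induction (grading 𝒜 deg) with
    | hom i x hx => rw [scaleHom_of_mem _ _ hx, scaleHom_of_mem _ _ (hmem i x hx), map_smul]
    | add x y hx hy => simp only [map_add, hx, hy]
  refine ⟨hmem, fun x => ?_⟩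
  induction x using FreeExt.induction with
  | h_inl a => simp [hg.comm_d]
  | h_gen s => simp [hd]
  | add x y hx hy => simp only [map_add, hx, hy]
  | mul x y hx hy => simp only [map_mul, Differential.d_mul, map_add, hx, hy, hscale]

end Differential

section Double

open Classical in
variable (𝒜 deg) in
/-- The double derivation dual to a generator. -/
noncomputable def dbl (s : S) : FreeExt R A S →ₗ[R] FreeExt R A S ⊗[R] FreeExt R A S :=
  der (Algebra.TensorProduct.includeLeft.comp (scaleHom (grading 𝒜 deg) ((-1) ^ deg s)))
    Algebra.TensorProduct.includeRight 0 (by simp) (fun t => if t = s then 1 else 0)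

@[simp] theorem dbl_inl (s : S) (a : A) : dbl 𝒜 deg s (inl a) = 0 := by simp [dbl]

theorem dbl_gen_self (s : S) : dbl 𝒜 deg s (gen s) = 1 := by simp [dbl]

theorem dbl_gen_of_ne {s t : S} (h : t ≠ s) : dbl 𝒜 deg s (gen t) = 0 := by simp [dbl, h]

theorem dbl_mul (s : S) (x y : FreeExt R A S) : dbl 𝒜 deg s (x * y) =
    (scaleHom (grading 𝒜 deg) ((-1) ^ deg s) x ⊗ₜ 1) * dbl 𝒜 deg s y +
      dbl 𝒜 deg s x * (1 ⊗ₜ y) :=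
  der_mul _ _ _ _ _ _ _

theorem dbl_mem (s : S) {n : ℕ} {x : FreeExt R A S} (hx : x ∈ grading 𝒜 deg n) :
    dbl 𝒜 deg s x ∈ tensorGr (grading 𝒜 deg) n (deg s) := by
  replace hx : IsHomog 𝒜 deg n x := hx
  induction hx with
  | inl n a ha => rw [dbl_inl]; exact Submodule.zero_mem _
  | gen t =>
    by_cases h : t = s
    · subst h
      rw [dbl_gen_self]
      exact tmul_mem_tensorGr (by omega) SetLike.GradedOne.one_mem SetLike.GradedOne.one_mem
    · rw [dbl_gen_of_ne h]; exact Submodule.zero_mem _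
  | add n x y _ _ hx hy => rw [map_add]; exact Submodule.add_mem _ hx hy
  | smul n r x _ hx => rw [map_smul]; exact Submodule.smul_mem _ _ hx
  | mul i j x y h1 h2 hx hy =>
    rw [dbl_mul]
    exact Submodule.add_mem _ (mul_left_mem_tensorGr (scaleHom_mem _ _ h1) hy)
      (mul_right_mem_tensorGr h2 hx)

theorem dbl_eq_zero_of_lt {s : S} {n : ℕ} (h : n < deg s) {x : FreeExt R A S}
    (hx : x ∈ grading 𝒜 deg n) : dbl 𝒜 deg s x = 0 :=
  eq_zero_of_mem_tensorGr h (dbl_mem s hx)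

theorem dbl_scaleHom (s : S) (c : R) (x : FreeExt R A S) :
    dbl 𝒜 deg s (scaleHom (grading 𝒜 deg) c x) =
      c ^ deg s • tensorScale (grading 𝒜 deg) c (dbl 𝒜 deg s x) := by
  induction x using homogeneous_induction (grading 𝒜 deg) with
  | hom i x hx => rw [tensorScale_of_mem c (dbl_mem s hx), scaleHom_of_mem _ c hx, map_smul]
  | add x y hx hy => simp only [map_add, hx, hy, smul_add]

theorem dbl_d (D : Differential R (grading (S := S) 𝒜 deg))
    (h_inl : ∀ a, ∃ b, D.d (inl a) = inl b) (h_gen : ∀ s, ∃ b, D.d (gen s) = inl b)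
    (s : S) (x : FreeExt R A S) :
    dbl 𝒜 deg s (D.d x) = (-1 : R) ^ deg s • tensorD D (dbl 𝒜 deg s x) := by
  induction x using FreeExt.induction with
  | h_inl a =>
    obtain ⟨b, hb⟩ := h_inl a
    rw [hb]; simp
  | h_gen t =>
    obtain ⟨b, hb⟩ := h_gen t
    rw [hb, dbl_inl]
    by_cases h : t = s
    · subst h
      rw [dbl_gen_self, Algebra.TensorProduct.one_def, tensorD_tmul, D.d_one]
      simp
    · rw [dbl_gen_of_ne h]; simp
  | add x y hx hy => simp only [map_add, hx, hy, smul_add]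
  | mul x y hx hy =>
    rw [D.d_mul, map_add, dbl_mul, dbl_mul, dbl_mul, map_add, tensorD_mul_left,
      tensorD_mul_right, hx, hy, dbl_scaleHom, D.d_scale, scaleHom_scaleHom, scaleHom_scaleHom,
      mul_comm (-1 : R)]
    simp only [smul_add, smul_mul_assoc, mul_smul_comm, ← TensorProduct.smul_tmul']
    abel

theorem finite_dbl_ne_zero (x : FreeExt R A S) : {s | dbl 𝒜 deg s x ≠ 0}.Finite := by
  induction x using FreeExt.induction with
  | h_inl a => simp
  | h_gen t =>
    refine (Set.finite_singleton t).subset fun s hs => ?_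
    by_contra h
    exact hs (dbl_gen_of_ne (Ne.symm h))
  | add x y hx hy =>
    refine (hx.union hy).subset fun s hs => ?_
    by_contra h
    obtain ⟨h1, h2⟩ := not_or.1 h
    exact hs (by rw [map_add, not_not.1 h1, not_not.1 h2, add_zero])
  | mul x y hx hy =>
    refine (hx.union hy).subset fun s hs => ?_
    by_contra h
    obtain ⟨h1, h2⟩ := not_or.1 h
    exact hs (by rw [dbl_mul, not_not.1 h1, not_not.1 h2, mul_zero, zero_mul, add_zero])

variable (𝒜 deg) in
/-- Insertion of a generator in the middle of a tensor. -/
noncomputable def insert (s : S) : FreeExt R A S ⊗[R] FreeExt R A S →ₗ[R] FreeExt R A S :=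
  LinearMap.mul' R _ ∘ₗ TensorProduct.map (LinearMap.mulRight R (gen s) ∘ₗ
    (inl.comp (retr.comp (scaleHom (grading 𝒜 deg) ((-1) ^ deg s)))).toLinearMap) LinearMap.id

theorem insert_tmul (s : S) (x y : FreeExt R A S) : insert 𝒜 deg s (x ⊗ₜ y) =
    inl (retr (scaleHom (grading 𝒜 deg) ((-1) ^ deg s) x)) * gen s * y := rfl

theorem insert_mul_left (s : S) (x : FreeExt R A S) (m : FreeExt R A S ⊗[R] FreeExt R A S) :
    insert 𝒜 deg s ((scaleHom (grading 𝒜 deg) ((-1) ^ deg s) x ⊗ₜ 1) * m) =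
      inl (retr x) * insert 𝒜 deg s m := by
  induction m using TensorProduct.induction_on with
  | zero => simp
  | tmul a b =>
    simp only [Algebra.TensorProduct.tmul_mul_tmul, insert_tmul, map_mul, scaleHom_scaleHom,
      one_mul, mul_assoc]
    rw [← mul_pow, neg_one_mul, neg_neg, one_pow, scaleHom_one]
  | add m n hm hn => rw [mul_add, map_add, map_add, hm, hn, mul_add]

theorem insert_mul_right (s : S) (y : FreeExt R A S) (m : FreeExt R A S ⊗[R] FreeExt R A S) :
    insert 𝒜 deg s (m * (1 ⊗ₜ y)) = insert 𝒜 deg s m * y := by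
  induction m using TensorProduct.induction_on with
  | zero => simp
  | tmul a b =>
    simp only [Algebra.TensorProduct.tmul_mul_tmul, insert_tmul, mul_one, mul_assoc]
  | add m n hm hn => rw [add_mul, map_add, map_add, hm, hn, add_mul]

open Classical in
theorem exists_eq_retr_add_sum (x : FreeExt R A S) : ∃ F : Finset S, ∀ F', F ⊆ F' →
    x = inl (retr x) + ∑ s ∈ F', insert 𝒜 deg s (dbl 𝒜 deg s x) := by
  induction x using FreeExt.induction with
  | h_inl a => exact ⟨∅, fun F' _ => by simp⟩
  | h_gen t =>
    refine ⟨{t}, fun F' hF => ?_⟩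
    rw [Finset.sum_eq_single t]
    · rw [dbl_gen_self, Algebra.TensorProduct.one_def, insert_tmul]
      simp
    · intro s _ hs
      rw [dbl_gen_of_ne (Ne.symm hs), map_zero]
    · intro h
      exact absurd (hF (Finset.mem_singleton_self t)) h
  | add x y hx hy =>
    obtain ⟨F, hF⟩ := hx
    obtain ⟨G, hG⟩ := hy
    refine ⟨F ∪ G, fun F' h => ?_⟩
    have h1 := hF F' (Finset.union_subset_left h)
    have h2 := hG F' (Finset.union_subset_right h)
    simp only [map_add, Finset.sum_add_distrib]
    rw [add_add_add_comm, ← h1, ← h2]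
  | mul x y hx hy =>
    obtain ⟨F, hF⟩ := hx
    obtain ⟨G, hG⟩ := hy
    refine ⟨F ∪ G, fun F' h => ?_⟩
    have h1 := hF F' (Finset.union_subset_left h)
    have h2 := hG F' (Finset.union_subset_right h)
    simp only [dbl_mul, map_add, map_mul, insert_mul_left, insert_mul_right,
      Finset.sum_add_distrib, ← Finset.mul_sum, ← Finset.sum_mul]
    rw [← add_assoc, ← mul_add, ← h2, ← add_mul, ← h1]

variable (𝒜 deg) in
theorem eq_inl_retr_of_dbl_eq_zero {x : FreeExt R A S} (h : ∀ s, dbl 𝒜 deg s x = 0) :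
    x = inl (retr x) := by
  obtain ⟨F, hF⟩ := exists_eq_retr_add_sum (𝒜 := 𝒜) (deg := deg) x
  have := hF F subset_rfl
  simpa [h] using this

theorem mem_zero_iff (h_deg : ∀ s, 1 ≤ deg s) {x : FreeExt R A S} (hx : x ∈ grading 𝒜 deg 0) :
    ∃ a ∈ 𝒜 0, inl a = x :=
  ⟨retr x, retr_mem hx, (eq_inl_retr_of_dbl_eq_zero 𝒜 deg fun s =>
    dbl_eq_zero_of_lt (h_deg s) hx).symm⟩

theorem insert_mem (s : S) {n : ℕ} {m : FreeExt R A S ⊗[R] FreeExt R A S}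
    (hm : m ∈ tensorGr (grading 𝒜 deg) n (deg s)) : insert 𝒜 deg s m ∈ grading 𝒜 deg n := by
  refine map_tensorGr_mem (F := insert 𝒜 deg s) ?_ hm
  rintro i j rfl a ha b hb
  rw [insert_tmul, add_right_comm]
  exact SetLike.mul_mem_graded (SetLike.mul_mem_graded
    (inl_mem (retr_mem (scaleHom_mem _ _ ha))) (gen_mem s)) hb

theorem dbl_insert (h_deg : ∀ s, 1 ≤ deg s) (s : S)
    {m : FreeExt R A S ⊗[R] FreeExt R A S}
    (hm : m ∈ tensorGr (grading 𝒜 deg) (deg s) (deg s)) :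
    dbl 𝒜 deg s (insert 𝒜 deg s m) = m := by
  refine eqOn_tensorGr (F := dbl 𝒜 deg s ∘ₗ insert 𝒜 deg s) (G := LinearMap.id) ?_ hm
  intro i j hij a ha b hb
  obtain rfl : i = 0 := by omega
  obtain rfl : j = 0 := by omega
  obtain ⟨a, ha', rfl⟩ := mem_zero_iff h_deg ha
  obtain ⟨b, hb, rfl⟩ := mem_zero_iff h_deg hb
  simp [insert_tmul, dbl_mul, dbl_gen_self, scaleHom_inl, scaleHom_of_mem 𝒜 _ ha']

theorem dbl_insert_of_ne (h_deg : ∀ s, 1 ≤ deg s) {s t : S} (h : s ≠ t)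
    {m : FreeExt R A S ⊗[R] FreeExt R A S}
    (hm : m ∈ tensorGr (grading 𝒜 deg) (deg s) (deg s)) :
    dbl 𝒜 deg t (insert 𝒜 deg s m) = 0 := by
  refine eqOn_tensorGr (F := dbl 𝒜 deg t ∘ₗ insert 𝒜 deg s) (G := 0) ?_ hm
  intro i j hij a ha b hb
  obtain rfl : j = 0 := by omega
  obtain ⟨b, hb, rfl⟩ := mem_zero_iff h_deg hb
  simp [insert_tmul, dbl_mul, dbl_gen_of_ne h]

end Double

end FreeExt

section CohomologyElements

variable {R : Type u} [CommRing R]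
  {A : Type u} [Ring A] [Algebra R A] {𝒜 : ℕ → Submodule R A} [GradedAlgebra 𝒜]
  {B : Type u} [Ring B] [Algebra R B] {ℬ : ℕ → Submodule R B} [GradedAlgebra ℬ]
  (DA : Differential R 𝒜) (DB : Differential R ℬ)

theorem Differential.proj_succ_d (n : ℕ) (a : A) :
    GradedRing.proj 𝒜 (n + 1) (DA.d a) = DA.d (GradedRing.proj 𝒜 n a) := by
  induction a using homogeneous_induction 𝒜 with
  | hom i a ha =>
    have h := DA.d_degree i a ha
    by_cases hi : i = n
    · subst hi
      simp [GradedRing.proj_apply, DirectSum.decompose_of_mem_same 𝒜 ha,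
        DirectSum.decompose_of_mem_same 𝒜 h]
    · simp [GradedRing.proj_apply, DirectSum.decompose_of_mem_ne 𝒜 ha hi,
        DirectSum.decompose_of_mem_ne 𝒜 h (show i + 1 ≠ n + 1 by omega)]
  | add a b ha hb => simp only [map_add, ha, hb]

theorem Differential.proj_zero_d (a : A) : GradedRing.proj 𝒜 0 (DA.d a) = 0 := by
  induction a using homogeneous_induction 𝒜 with
  | hom i a ha =>
    simp [GradedRing.proj_apply,
      DirectSum.decompose_of_mem_ne 𝒜 (DA.d_degree i a ha) (show i + 1 ≠ 0 by omega)]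
  | add a b ha hb => simp only [map_add, ha, hb, add_zero]

theorem mem_cobounds_succ {n : ℕ} {x : A} :
    x ∈ cobounds DA (n + 1) ↔ ∃ y ∈ 𝒜 n, DA.d y = x := by
  constructor
  · rintro ⟨hx, y, hy⟩
    refine ⟨GradedRing.proj 𝒜 n y, SetLike.coe_mem _, ?_⟩
    rw [← DA.proj_succ_d, hy, GradedRing.proj_apply, DirectSum.decompose_of_mem_same 𝒜 hx]
  · rintro ⟨y, hy, rfl⟩
    exact ⟨DA.d_degree n y hy, y, rfl⟩

theorem mem_cobounds_zero {x : A} : x ∈ cobounds DA 0 ↔ x = 0 := by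
  constructor
  · rintro ⟨hx, y, hy⟩
    rw [← DA.proj_zero_d y, hy, GradedRing.proj_apply, DirectSum.decompose_of_mem_same 𝒜 hx]
  · rintro rfl
    exact Submodule.zero_mem _

theorem exists_d_eq_of_subsingleton {n : ℕ} (h : Subsingleton (cohomology DA (n + 1))) {x : A}
    (hx : x ∈ 𝒜 (n + 1)) (hd : DA.d x = 0) : ∃ y ∈ 𝒜 n, DA.d y = x := by
  have h1 : (Submodule.Quotient.mk ⟨x, hx, hd⟩ : cohomology DA (n + 1)) = 0 :=
    Subsingleton.elim _ _
  rw [Submodule.Quotient.mk_eq_zero] at h1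
  exact (mem_cobounds_succ DA).1 h1

theorem inducedH_mk {f : A →ₐ[R] B} (hf : IsDGAHom DA DB f) {i : ℕ} (x : cocycles DA i)
    (y : cocycles DB i) (hxy : f x = y) :
    inducedH DA DB f hf i (Submodule.Quotient.mk x) = Submodule.Quotient.mk y := by
  have : (⟨f x, hxy ▸ y.2⟩ : cocycles DB i) = y := Subtype.ext hxy
  rw [← this]
  rfl

theorem mem_cobounds_of_inducedH_injective {f : A →ₐ[R] B} (hf : IsDGAHom DA DB f) {i : ℕ}
    (h : Function.Injective (inducedH DA DB f hf i)) {x : A} (hx : x ∈ 𝒜 i)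
    (hd : DA.d x = 0) (hfx : f x ∈ cobounds DB i) : x ∈ cobounds DA i := by
  have hdf : DB.d (f x) = 0 := by rw [← hf.comm_d, hd, map_zero]
  have h1 := inducedH_mk DA DB hf (i := i) ⟨x, hx, hd⟩ ⟨f x, hf.map_degree i x hx, hdf⟩ rfl
  have h2 : (Submodule.Quotient.mk ⟨f x, hf.map_degree i x hx, hdf⟩ : cohomology DB i) = 0 := by
    rw [Submodule.Quotient.mk_eq_zero]
    exact hfx
  rw [h2, ← map_zero (inducedH DA DB f hf i)] at h1
  have h3 := h h1
  rwa [Submodule.Quotient.mk_eq_zero] at h3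

theorem inducedH_bijective {f : A →ₐ[R] B} (hf : IsDGAHom DA DB f) {i : ℕ}
    (inj : ∀ x ∈ 𝒜 i, DA.d x = 0 → f x ∈ cobounds DB i → x ∈ cobounds DA i)
    (surj : ∀ y ∈ ℬ i, DB.d y = 0 → ∃ x ∈ 𝒜 i, DA.d x = 0 ∧ f x - y ∈ cobounds DB i) :
    Function.Bijective (inducedH DA DB f hf i) := by
  constructor
  · rw [← LinearMap.ker_eq_bot, Submodule.eq_bot_iff]
    intro x hx
    obtain ⟨⟨x, hx1, hx2⟩, rfl⟩ := Submodule.Quotient.mk_surjective _ x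
    have hd : DB.d (f x) = 0 := by rw [← hf.comm_d, show DA.d x = 0 from hx2, map_zero]
    rw [LinearMap.mem_ker, inducedH_mk DA DB hf _ ⟨f x, hf.map_degree i x hx1, hd⟩ rfl,
      Submodule.Quotient.mk_eq_zero] at hx
    rw [Submodule.Quotient.mk_eq_zero]
    exact inj x hx1 hx2 hx
  · intro y
    obtain ⟨⟨y, hy1, hy2⟩, rfl⟩ := Submodule.Quotient.mk_surjective _ y
    obtain ⟨x, hx, hd, hxy⟩ := surj y hy1 hy2
    have hdf : DB.d (f x) = 0 := by rw [← hf.comm_d, hd, map_zero]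
    refine ⟨Submodule.Quotient.mk ⟨x, hx, hd⟩, ?_⟩
    rw [inducedH_mk DA DB hf _ ⟨f x, hf.map_degree i x hx, hdf⟩ rfl, Submodule.Quotient.eq]
    exact hxy

theorem cocycles_zero_of_equiv (e : cohomology DA 0 ≃ₗ[R] R) :
    (∀ x ∈ 𝒜 0, DA.d x = 0 → ∃ c : R, c • 1 = x) ∧ ∀ c : R, c • (1 : A) = 0 → c = 0 := by
  let g : cocycles DA 0 →ₗ[R] R := e.toLinearMap ∘ₗ Submodule.mkQ _
  have g_inj : ∀ x, g x = 0 → x = 0 := by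
    intro x hx
    have h1 : (Submodule.Quotient.mk x : cohomology DA 0) = 0 := e.map_eq_zero_iff.1 hx
    rw [Submodule.Quotient.mk_eq_zero] at h1
    exact Subtype.ext ((mem_cobounds_zero DA).1 h1)
  obtain ⟨u, hu⟩ : ∃ u, g u = 1 := by
    obtain ⟨u, hu⟩ := Submodule.Quotient.mk_surjective _ (e.symm 1)
    refine ⟨u, ?_⟩
    show e (Submodule.Quotient.mk u) = 1
    rw [hu, e.apply_symm_apply]
  have key : ∀ x, x = g x • u := by
    intro x
    refine sub_eq_zero.1 (g_inj _ ?_)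
    rw [map_sub, map_smul, hu, smul_eq_mul, mul_one, sub_self]
  have hu0 : DA.d u = 0 := u.2.2
  let one : cocycles DA 0 := ⟨1, SetLike.one_mem_graded 𝒜, DA.d_one⟩
  let uu : cocycles DA 0 := ⟨u * u, by
    have := SetLike.mul_mem_graded u.2.1 u.2.1
    rwa [add_zero] at this, by
    show DA.d ((u : A) * u) = 0
    rw [DA.d_mul, hu0, mul_zero, zero_mul, add_zero]⟩
  have h1 : (1 : A) = g one • (u : A) := congrArg Subtype.val (key one)
  have h2 : (u : A) * u = g uu • (u : A) := congrArg Subtype.val (key uu)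
  have h3 : (u : A) = (g one * g uu) • (u : A) := by
    calc (u : A) = 1 * u := (one_mul _).symm
      _ = (g one * g uu) • (u : A) := by
        nth_rewrite 1 [h1]
        rw [smul_mul_assoc, h2, smul_smul]
  have h4 : g one * g uu = 1 := by
    have : u = (g one * g uu) • u := Subtype.ext h3
    have h := congrArg g this
    rw [map_smul, hu, smul_eq_mul, mul_one] at h
    exact h.symm
  refine ⟨fun x hx hd => ?_, fun c hc => ?_⟩
  · have hx' : x = g ⟨x, hx, hd⟩ • (u : A) := congrArg Subtype.val (key ⟨x, hx, hd⟩)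
    refine ⟨g ⟨x, hx, hd⟩ * g uu, ?_⟩
    rw [h1, smul_smul, mul_assoc, mul_comm (g uu), h4, mul_one, ← hx']
  · have h5 : (c * g one) • u = 0 := Subtype.ext (by
      show (c * g one) • (u : A) = 0
      rw [← smul_smul, ← h1, hc])
    have h := congrArg g h5
    rw [map_smul, hu, smul_eq_mul, mul_one, map_zero] at h
    rw [← mul_one c, ← h4, ← mul_assoc, h, zero_mul]

end CohomologyElements

section Contraction

variable {R : Type u} [CommRing R]
  {A : Type u} [Ring A] [Algebra R A] {𝒜 : ℕ → Submodule R A} [GradedAlgebra 𝒜]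
  {X : Type u} [Ring X] [Algebra R X] {𝒳 : ℕ → Submodule R X} [GradedAlgebra 𝒳]

variable (𝒜) in
/-- The projection onto a homogeneous component. -/
noncomputable def component (n : ℕ) : A →ₗ[R] 𝒜 n :=
  DirectSum.component R ℕ (fun i => 𝒜 i) n ∘ₗ (DirectSum.decomposeLinearEquiv 𝒜).toLinearMap

theorem component_of_mem {n : ℕ} {a : A} (ha : a ∈ 𝒜 n) : component 𝒜 n a = ⟨a, ha⟩ :=
  Subtype.ext (DirectSum.decompose_of_mem_same 𝒜 ha)

theorem component_of_mem_ne {m n : ℕ} (h : m ≠ n) {a : A} (ha : a ∈ 𝒜 m) :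
    component 𝒜 n a = 0 :=
  Subtype.ext (DirectSum.decompose_of_mem_ne 𝒜 ha h)

theorem Differential.exists_section [IsDomain R] [IsPrincipalIdealRing R] [Module.Free R A]
    (D : Differential R 𝒜) (n : ℕ) :
    ∃ s : (𝒜 n).map D.d →ₗ[R] 𝒜 n, ∀ x, D.d (s x) = x := by
  have : Module.Free R ((𝒜 n).map D.d) := free_submodule _
  let g : 𝒜 n →ₗ[R] (𝒜 n).map D.d := D.d.submoduleMap (𝒜 n)
  obtain ⟨s, hs⟩ := Module.projective_lifting_property g LinearMap.id
    (D.d.submoduleMap_surjective (𝒜 n))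
  exact ⟨s, fun x => congrArg Subtype.val (DFunLike.congr_fun hs x)⟩

theorem exists_lowContraction [IsDomain R] [IsPrincipalIdealRing R] [Module.Free R A]
    (D : Differential R 𝒜) (h0 : ∀ x ∈ 𝒜 0, D.d x = 0 → ∃ c : R, c • 1 = x)
    (h0' : ∀ c : R, c • (1 : A) = 0 → c = 0)
    (h1 : ∀ x ∈ 𝒜 1, D.d x = 0 → ∃ y ∈ 𝒜 0, D.d y = x) : Nonempty (LowContraction D A) := by
  obtain ⟨s, hs⟩ := D.exists_section 0
  obtain ⟨t, ht⟩ := D.exists_section 1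
  let q : 𝒜 1 →ₗ[R] (𝒜 0).map D.d :=
    LinearMap.codRestrict _ ((𝒜 1).subtype - (𝒜 1).subtype ∘ₗ t ∘ₗ D.d.submoduleMap (𝒜 1)) (by
      intro x
      refine h1 _ (Submodule.sub_mem _ x.2 (SetLike.coe_mem _)) ?_
      show D.d ((x : A) - t (D.d.submoduleMap (𝒜 1) x)) = 0
      rw [map_sub, ht]
      exact sub_self _)
  let h : A →ₗ[R] A := (𝒜 0).subtype ∘ₗ s ∘ₗ q ∘ₗ component 𝒜 1
  have hd : ∀ a ∈ 𝒜 0, D.d (h (D.d a)) = D.d a := by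
    intro a ha
    have : ((q ⟨D.d a, D.d_degree 0 a ha⟩ : (𝒜 0).map D.d) : A) = D.d a := by
      show D.d a - t (D.d.submoduleMap (𝒜 1) ⟨D.d a, D.d_degree 0 a ha⟩) = D.d a
      have : D.d.submoduleMap (𝒜 1) ⟨D.d a, D.d_degree 0 a ha⟩ = 0 :=
        Subtype.ext (D.d_squared a)
      rw [this, map_zero, Submodule.coe_zero, sub_zero]
    show D.d (s (q (component 𝒜 1 (D.d a)))) = D.d a
    rw [hs, component_of_mem (D.d_degree 0 a ha), this]
  let e : R ≃ₗ[R] cocycles D 0 := LinearEquiv.ofBijective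
    (LinearMap.toSpanSingleton R (cocycles D 0) ⟨1, SetLike.one_mem_graded 𝒜, D.d_one⟩)
    ⟨(injective_iff_map_eq_zero _).2 fun c hc => h0' c (congrArg Subtype.val hc), fun x => by
      obtain ⟨c, hc⟩ := h0 x x.2.1 x.2.2
      exact ⟨c, Subtype.ext hc⟩⟩
  let p : 𝒜 0 →ₗ[R] cocycles D 0 :=
    LinearMap.codRestrict _ ((LinearMap.id - h ∘ₗ D.d) ∘ₗ (𝒜 0).subtype) (by
      intro x
      refine ⟨Submodule.sub_mem _ x.2 (SetLike.coe_mem _), ?_⟩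
      show D.d ((x : A) - h (D.d x)) = 0
      rw [map_sub, hd x x.2, sub_self])
  have he : ∀ x, (e.symm x) • (1 : A) = x := fun x =>
    congrArg Subtype.val (e.apply_symm_apply x)
  exact ⟨{
    h := h
    ε := e.symm.toLinearMap ∘ₗ p ∘ₗ component 𝒜 0
    i := LinearMap.id
    r := (𝒜 0).subtype ∘ₗ component 𝒜 0
    h_mem := fun x _ => SetLike.coe_mem _
    h_zero := fun n hn x hx => by simp [h, component_of_mem_ne hn hx]
    ε_zero := fun n hn x hx => by simp [component_of_mem_ne hn hx]
    r_zero := fun n hn x hx => by simp [component_of_mem_ne hn hx]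
    ir := fun x hx => by simp [component_of_mem hx]
    h_d := fun x hx => by
      simp only [LinearMap.comp_apply, LinearEquiv.coe_coe, component_of_mem hx, he]
      show h (D.d x) = x - (x - h (D.d x))
      abel
    ε_one := by
      simp only [LinearMap.comp_apply, LinearEquiv.coe_coe,
        component_of_mem (SetLike.one_mem_graded 𝒜)]
      rw [LinearEquiv.symm_apply_eq]
      ext1
      show (1 : A) - h (D.d 1) = (1 : R) • 1
      rw [D.d_one, map_zero, sub_zero, one_smul] }⟩

/-- Transport of a low degree contraction along an extension without new generators in degree
zero. -/
noncomputable def LowContraction.extend {D : Differential R 𝒜} {DX : Differential R 𝒳}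
    {M : Type u} [AddCommGroup M] [Module R M]
    (C : LowContraction D M) {ι : A →ₐ[R] X} (hι : IsDGAHom D DX ι) {r : X →ₐ[R] A}
    (hr : ∀ n, ∀ x ∈ 𝒳 n, r x ∈ 𝒜 n) (hrι : ∀ a, r (ι a) = a)
    (h_zero : ∀ x ∈ 𝒳 0, ∃ a ∈ 𝒜 0, ι a = x) : LowContraction DX M where
  h := ι.toLinearMap ∘ₗ C.h ∘ₗ r.toLinearMap
  ε := C.ε ∘ₗ r.toLinearMap
  i := ι.toLinearMap ∘ₗ C.i
  r := C.r ∘ₗ r.toLinearMap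
  h_mem x hx := hι.map_degree 0 _ (C.h_mem _ (hr 1 x hx))
  h_zero n hn x hx := by simp [C.h_zero n hn _ (hr n x hx)]
  ε_zero n hn x hx := C.ε_zero n hn _ (hr n x hx)
  r_zero n hn x hx := C.r_zero n hn _ (hr n x hx)
  ir x hx := by
    obtain ⟨a, ha, rfl⟩ := h_zero x hx
    simp [hrι, C.ir a ha]
  h_d x hx := by
    obtain ⟨a, ha, rfl⟩ := h_zero x hx
    simp [hrι, ← hι.comm_d, C.h_d a ha]
  ε_one := by simp [C.ε_one]

end Contraction

theorem LowContraction.aug_tensorD {R : Type u} [CommRing R] {A : Type u} [AddCommGroup A]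
    [Module R A] {X : Type u} [Ring X] [Algebra R X]
    {𝒳 : ℕ → Submodule R X} [GradedAlgebra 𝒳] {D : Differential R 𝒳} (C : LowContraction D A)
    (m : X ⊗[R] X) : C.aug (tensorD D m) = 0 := by
  have h : ∀ a, C.ε (D.d a) = 0 := by
    intro a
    induction a using homogeneous_induction 𝒳 with
    | hom i a ha => exact C.ε_zero (i + 1) (by simp) _ (D.d_degree i a ha)
    | add a b ha hb => rw [map_add, map_add, ha, hb, add_zero]
  induction m using TensorProduct.induction_on with
  | zero => simp
  | tmul a b => simp [h]
  | add m n hm hn => rw [map_add, map_add, hm, hn, add_zero]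

section Stages

variable {R : Type u} [CommRing R]
  {A : Type u} [Ring A] [Algebra R A] {𝒜 : ℕ → Submodule R A} [GradedAlgebra 𝒜]
  {B : Type u} [Ring B] [Algebra R B] {ℬ : ℕ → Submodule R B} [GradedAlgebra ℬ]

/-- A partial model: a factorization of `f` through an extension of `A` with a retraction, no
cohomology in degree one, and a basis of the kernel of the induced map in degree two. -/
structure Stage (DA : Differential R 𝒜) (DB : Differential R ℬ) (f : A →ₐ[R] B) where
  X : GradedDGA R
  ι : A →ₐ[R] X.carrier
  φ : X.carrier →ₐ[R] B
  r : X.carrier →ₐ[R] A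
  hι : IsDGAHom DA X.diff ι
  hφ : IsDGAHom X.diff DB φ
  φι : ∀ a, φ (ι a) = f a
  r_mem : ∀ n, ∀ x ∈ X.grading n, r x ∈ 𝒜 n
  rι : ∀ a, r (ι a) = a
  zero : ∀ x ∈ X.grading 0, ∃ a ∈ 𝒜 0, ι a = x
  H1 : ∀ x ∈ X.grading 1, X.diff.d x = 0 → ∃ y ∈ X.grading 0, X.diff.d y = x
  K : Type u
  κ : K → X.carrier
  β : K → B
  κ_mem : ∀ k, κ k ∈ X.grading 2
  d_κ : ∀ k, X.diff.d (κ k) = 0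
  β_mem : ∀ k, β k ∈ ℬ 1
  φκ : ∀ k, φ (κ k) = DB.d (β k)
  indep : ∀ c : K →₀ R, ∀ y ∈ X.grading 1,
    X.diff.d y = Finsupp.linearCombination R κ c → c = 0
  span : ∀ z ∈ X.grading 2, X.diff.d z = 0 → (∃ b ∈ ℬ 1, DB.d b = φ z) →
    ∃ c, ∃ y ∈ X.grading 1, z = Finsupp.linearCombination R κ c + X.diff.d y

namespace Stage

variable {DA : Differential R 𝒜} {DB : Differential R ℬ} {f : A →ₐ[R] B} (𝒮 : Stage DA DB f)

/-- The relative cocycles of degree at least two. -/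
def Pairs : Type u :=
  {p : ℕ × 𝒮.X.carrier × B // 2 ≤ p.1 ∧ p.2.1 ∈ 𝒮.X.grading (p.1 + 1) ∧ 𝒮.X.diff.d p.2.1 = 0 ∧
    p.2.2 ∈ ℬ p.1 ∧ 𝒮.φ p.2.1 = DB.d p.2.2}

/-- The generators adjoined to a stage. -/
def Gen : Type u := 𝒮.K ⊕ 𝒮.Pairs

variable {𝒮}

/-- The generator killing a basis element of the kernel in degree two. -/
def Gen.ofK (k : 𝒮.K) : 𝒮.Gen := Sum.inl k

theorem Gen.ofK_injective : Function.Injective (Gen.ofK (𝒮 := 𝒮)) := Sum.inl_injective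

/-- The generator attached to a relative cocycle. -/
def Gen.ofPair (p : 𝒮.Pairs) : 𝒮.Gen := Sum.inr p

/-- The degree of a generator. -/
def Gen.deg : 𝒮.Gen → ℕ := Sum.elim (fun _ => 1) (fun p => p.1.1)

/-- The boundary of a generator. -/
def Gen.bd : 𝒮.Gen → 𝒮.X.carrier := Sum.elim 𝒮.κ (fun p => p.1.2.1)

/-- The image of a generator in `B`. -/
def Gen.val : 𝒮.Gen → B := Sum.elim 𝒮.β (fun p => p.1.2.2)

theorem Gen.one_le_deg (s : 𝒮.Gen) : 1 ≤ s.deg := by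
  rcases s with k | p
  · exact le_rfl
  · exact le_trans (by norm_num) p.2.1

theorem Gen.bd_mem (s : 𝒮.Gen) : s.bd ∈ 𝒮.X.grading (s.deg + 1) := by
  rcases s with k | p
  · exact 𝒮.κ_mem k
  · exact p.2.2.1

theorem Gen.d_bd (s : 𝒮.Gen) : 𝒮.X.diff.d s.bd = 0 := by
  rcases s with k | p
  · exact 𝒮.d_κ k
  · exact p.2.2.2.1

theorem Gen.val_mem (s : 𝒮.Gen) : s.val ∈ ℬ s.deg := by
  rcases s with k | p
  · exact 𝒮.β_mem k
  · exact p.2.2.2.2.1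

theorem Gen.φ_bd (s : 𝒮.Gen) : 𝒮.φ s.bd = DB.d s.val := by
  rcases s with k | p
  · exact 𝒮.φκ k
  · exact p.2.2.2.2.2

variable (𝒮)

/-- The underlying algebra of the next stage. -/
abbrev Next : Type u := FreeExt R 𝒮.X.carrier 𝒮.Gen

/-- The grading of the next stage. -/
abbrev nextGrading : ℕ → Submodule R 𝒮.Next := FreeExt.grading 𝒮.X.grading Gen.deg

/-- The differential of the next stage. -/
noncomputable def nextDiff : Differential R 𝒮.nextGrading :=
  FreeExt.differential 𝒮.X.diff (bd := fun s => FreeExt.inl s.bd)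
    (fun s => FreeExt.inl_mem s.bd_mem) (fun s => by simp [FreeExt.derivation, s.d_bd])

@[simp] theorem nextDiff_inl (x : 𝒮.X.carrier) :
    𝒮.nextDiff.d (FreeExt.inl x) = FreeExt.inl (𝒮.X.diff.d x) :=
  FreeExt.differential_inl _ _ _ _

@[simp] theorem nextDiff_gen (s : 𝒮.Gen) :
    𝒮.nextDiff.d (FreeExt.gen s) = FreeExt.inl s.bd :=
  FreeExt.differential_gen _ _ _ _

/-- The map from the next stage to `B`. -/
noncomputable def nextφ : 𝒮.Next →ₐ[R] B := FreeExt.lift 𝒮.φ Gen.val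

theorem isDGAHom_nextφ : IsDGAHom 𝒮.nextDiff DB 𝒮.nextφ :=
  FreeExt.isDGAHom_lift _ _ _ _ 𝒮.hφ Gen.val_mem (fun s => by rw [FreeExt.lift_inl, s.φ_bd])

theorem isDGAHom_nextι : IsDGAHom DA 𝒮.nextDiff (FreeExt.inl.comp 𝒮.ι) :=
  ⟨fun n a ha => FreeExt.inl_mem (𝒮.hι.map_degree n a ha), fun a => by simp [𝒮.hι.comm_d]⟩

theorem next_zero (x : 𝒮.Next) (hx : x ∈ 𝒮.nextGrading 0) :
    ∃ a ∈ 𝒜 0, FreeExt.inl.comp 𝒮.ι a = x := by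
  obtain ⟨y, hy, rfl⟩ := FreeExt.mem_zero_iff Gen.one_le_deg hx
  obtain ⟨a, ha, rfl⟩ := 𝒮.zero y hy
  exact ⟨a, ha, rfl⟩

/-- The double derivations of the next stage. -/
noncomputable abbrev nextDbl (s : 𝒮.Gen) : 𝒮.Next →ₗ[R] 𝒮.Next ⊗[R] 𝒮.Next :=
  FreeExt.dbl 𝒮.X.grading Gen.deg s

theorem nextDbl_d (s : 𝒮.Gen) (x : 𝒮.Next) :
    𝒮.nextDbl s (𝒮.nextDiff.d x) =
      (-1 : R) ^ s.deg • tensorD 𝒮.nextDiff (𝒮.nextDbl s x) :=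
  FreeExt.dbl_d _ (fun a => ⟨_, 𝒮.nextDiff_inl a⟩) (fun s => ⟨_, 𝒮.nextDiff_gen s⟩) s x

theorem tensorD_nextDbl {x : 𝒮.Next} (hx : 𝒮.nextDiff.d x = 0) (s : 𝒮.Gen) :
    tensorD 𝒮.nextDiff (𝒮.nextDbl s x) = 0 := by
  have h := 𝒮.nextDbl_d s x
  rw [hx, map_zero] at h
  calc tensorD 𝒮.nextDiff (𝒮.nextDbl s x)
      = ((-1 : R) ^ s.deg * (-1) ^ s.deg) • tensorD 𝒮.nextDiff (𝒮.nextDbl s x) := by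
        rw [← mul_pow]; simp
    _ = 0 := by rw [mul_smul, ← h, smul_zero]

/-- The linear combinations of the generators of degree one. -/
noncomputable def genComb : (𝒮.K →₀ R) →ₗ[R] 𝒮.Next :=
  Finsupp.linearCombination R fun k => FreeExt.gen (Gen.ofK k)

theorem nextDiff_genComb (c : 𝒮.K →₀ R) :
    𝒮.nextDiff.d (𝒮.genComb c) = FreeExt.inl (Finsupp.linearCombination R 𝒮.κ c) := by
  have h : 𝒮.nextDiff.d ∘ₗ 𝒮.genComb =
      FreeExt.inl.toLinearMap ∘ₗ Finsupp.linearCombination R 𝒮.κ := by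
    ext k
    simp only [genComb, LinearMap.comp_apply, Finsupp.lsingle_apply,
      Finsupp.linearCombination_single, one_smul, AlgHom.toLinearMap_apply]
    exact 𝒮.nextDiff_gen _
  exact DFunLike.congr_fun h c

theorem genComb_mem (c : 𝒮.K →₀ R) : 𝒮.genComb c ∈ 𝒮.nextGrading 1 := by
  rw [genComb, Finsupp.linearCombination_apply]
  exact Submodule.sum_mem _ fun k _ => Submodule.smul_mem _ _ (FreeExt.gen_mem (Gen.ofK k))

theorem nextDbl_genComb (k : 𝒮.K) (c : 𝒮.K →₀ R) :
    𝒮.nextDbl (Gen.ofK k) (𝒮.genComb c) = c k • (1 ⊗ₜ[R] 1) := by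
  have h : 𝒮.nextDbl (Gen.ofK k) ∘ₗ 𝒮.genComb =
      (LinearMap.toSpanSingleton R _ (1 ⊗ₜ[R] 1)) ∘ₗ Finsupp.lapply k := by
    refine Finsupp.lhom_ext' fun j => LinearMap.ext_ring ?_
    simp only [genComb, LinearMap.comp_apply, Finsupp.lsingle_apply,
      Finsupp.linearCombination_single, one_smul, Finsupp.lapply_apply,
      LinearMap.toSpanSingleton_apply]
    by_cases h : j = k
    · subst h
      rw [Finsupp.single_eq_same, one_smul]
      exact FreeExt.dbl_gen_self _
    · rw [Finsupp.single_eq_of_ne (Ne.symm h), zero_smul]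
      exact FreeExt.dbl_gen_of_ne fun h' => h (Gen.ofK_injective h')
  exact DFunLike.congr_fun h c

variable {𝒮}

/-- The linear coefficients of an element of the next stage. -/
noncomputable def coeff (C : LowContraction 𝒮.nextDiff A) : 𝒮.Next →ₗ[R] 𝒮.Gen →₀ R where
  toFun x := Finsupp.ofSupportFinite (fun s => C.aug (𝒮.nextDbl s x))
    ((FreeExt.finite_dbl_ne_zero (𝒜 := 𝒮.X.grading) (deg := Gen.deg) x).subset fun s hs h =>
      hs (by simp only [h, map_zero]))
  map_add' x y := by
    ext s
    change C.aug _ = C.aug _ + C.aug _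
    rw [map_add, map_add]
  map_smul' c x := by
    ext s
    change C.aug _ = c • C.aug _
    rw [map_smul, map_smul]

theorem coeff_apply (C : LowContraction 𝒮.nextDiff A) (x : 𝒮.Next) (s : 𝒮.Gen) :
    coeff C x s = C.aug (𝒮.nextDbl s x) := rfl

theorem coeff_d (C : LowContraction 𝒮.nextDiff A) (x : 𝒮.Next) :
    coeff C (𝒮.nextDiff.d x) = 0 := by
  ext s
  rw [coeff_apply, 𝒮.nextDbl_d, map_smul, C.aug_tensorD, smul_zero]
  rfl

theorem next_H1 (C : LowContraction 𝒮.nextDiff A) (x : 𝒮.Next) (hx : x ∈ 𝒮.nextGrading 1) (hd : 𝒮.nextDiff.d x = 0) :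
    ∃ y ∈ 𝒮.nextGrading 0, 𝒮.nextDiff.d y = x := by
  let c : 𝒮.K →₀ R := (coeff C x).comapDomain Gen.ofK Gen.ofK_injective.injOn
  let g : 𝒮.Next := 𝒮.genComb c
  have hg : ∀ s : 𝒮.Gen, 𝒮.nextDbl s (x - g) = 0 := by
    rintro (k | p)
    · change 𝒮.nextDbl (Gen.ofK k) (x - 𝒮.genComb c) = 0
      rw [map_sub, 𝒮.nextDbl_genComb, sub_eq_zero]
      exact C.eq_aug_of_tensorD_eq_zero (n := 1) (k := 1) rfl
        (FreeExt.dbl_mem (deg := Gen.deg) (Gen.ofK k) hx) (𝒮.tensorD_nextDbl hd _)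
    · have hp : 1 < Gen.deg (Sum.inr p : 𝒮.Gen) := p.2.1
      exact FreeExt.dbl_eq_zero_of_lt hp
        (Submodule.sub_mem _ hx (𝒮.genComb_mem c))
  have h1 := FreeExt.eq_inl_retr_of_dbl_eq_zero 𝒮.X.grading Gen.deg hg
  have hy : FreeExt.retr (x - g) ∈ 𝒮.X.grading 1 :=
    FreeExt.retr_mem (Submodule.sub_mem _ hx (𝒮.genComb_mem c))
  have h2 : 𝒮.X.diff.d (FreeExt.retr (x - g)) = -Finsupp.linearCombination R 𝒮.κ c := by
    apply FreeExt.inl_injective (R := R) (S := 𝒮.Gen)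
    rw [← nextDiff_inl, ← h1, map_sub, hd, zero_sub, nextDiff_genComb, map_neg]
  have hc : c = 0 := by
    refine 𝒮.indep c (-FreeExt.retr (x - g)) (Submodule.neg_mem _ hy) ?_
    rw [map_neg, h2, neg_neg]
  have hg0 : g = 0 := by simp only [g, hc, map_zero]
  rw [hg0, sub_zero] at h1 h2 hy
  rw [hc, map_zero, neg_zero] at h2
  obtain ⟨y, hy, hyx⟩ := 𝒮.H1 _ hy h2
  exact ⟨FreeExt.inl y, FreeExt.inl_mem hy, by rw [nextDiff_inl, hyx, ← h1]⟩

theorem next_span_of_coeff_eq_zero [Module.Free R A] (C : LowContraction 𝒮.nextDiff A)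
    {x : 𝒮.Next} (hx : x ∈ 𝒮.nextGrading 2)
    (hd : 𝒮.nextDiff.d x = 0) (hφ : ∃ b ∈ ℬ 1, DB.d b = 𝒮.nextφ x) (hL : coeff C x = 0) :
    ∃ y ∈ 𝒮.nextGrading 1, 𝒮.nextDiff.d y = x := by
  have hz : ∀ s : 𝒮.Gen, ∃ z ∈ tensorGr 𝒮.nextGrading 1 s.deg,
      tensorD 𝒮.nextDiff z = 𝒮.nextDbl s x ∧ (s.deg ≠ 1 → z = 0) ∧
      (𝒮.nextDbl s x = 0 → z = 0) := by
    intro s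
    have hm := FreeExt.dbl_mem (deg := Gen.deg) s hx
    have hD := 𝒮.tensorD_nextDbl hd s
    by_cases h0 : 𝒮.nextDbl s x = 0
    · exact ⟨0, Submodule.zero_mem _, by rw [h0, map_zero], fun _ => rfl, fun _ => rfl⟩
    · have hs := s.one_le_deg
      by_cases h1 : s.deg = 1
      · obtain ⟨z, hz, hzD⟩ := C.exists_tensorD_eq (next_H1 C) (by rw [h1]) hm hD
        rw [h1] at hz ⊢
        exact ⟨z, hz, hzD, fun h => absurd rfl h, fun h => absurd h h0⟩
      · exfalso
        apply h0
        by_cases h2 : s.deg = 2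
        · have h3 := C.eq_aug_of_tensorD_eq_zero h2.symm hm hD
          have h4 : C.aug (𝒮.nextDbl s x) = 0 := DFunLike.congr_fun hL s
          rw [h3, h4, zero_smul]
        · exact FreeExt.dbl_eq_zero_of_lt (by omega) hx
  choose z hz_mem hz_D hz_ne hz_zero using hz
  let F : Finset 𝒮.Gen :=
    (FreeExt.finite_dbl_ne_zero (𝒜 := 𝒮.X.grading) (deg := Gen.deg) x).toFinset
  let y : 𝒮.Next := ∑ s ∈ F, FreeExt.insert 𝒮.X.grading Gen.deg s (z s)
  have hy : y ∈ 𝒮.nextGrading 1 :=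
    Submodule.sum_mem _ fun s _ => FreeExt.insert_mem s (hz_mem s)
  have hzz : ∀ s, z s ∈ tensorGr 𝒮.nextGrading s.deg s.deg := by
    intro s
    by_cases h : s.deg = 1
    · have := hz_mem s
      rwa [h] at this ⊢
    · rw [hz_ne s h]
      exact Submodule.zero_mem _
  have hyz : ∀ t, 𝒮.nextDbl t y = z t := by
    intro t
    rw [map_sum, Finset.sum_eq_single t]
    · exact FreeExt.dbl_insert Gen.one_le_deg t (hzz t)
    · intro s _ hst
      exact FreeExt.dbl_insert_of_ne Gen.one_le_deg hst (hzz s)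
    · intro ht
      have h0 : 𝒮.nextDbl t x = 0 := by
        by_contra h
        exact ht ((Set.Finite.mem_toFinset _).2 h)
      rw [hz_zero t h0, map_zero, map_zero]
  have hdbl : ∀ t, 𝒮.nextDbl t (x + 𝒮.nextDiff.d y) = 0 := by
    intro t
    rw [map_add, 𝒮.nextDbl_d, hyz, hz_D]
    by_cases h : t.deg = 1
    · rw [h]
      simp
    · have h0 : 𝒮.nextDbl t x = 0 := by rw [← hz_D, hz_ne t h, map_zero]
      rw [h0, smul_zero, add_zero]
  have hmem : x + 𝒮.nextDiff.d y ∈ 𝒮.nextGrading 2 :=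
    Submodule.add_mem _ hx (𝒮.nextDiff.d_degree 1 _ hy)
  have h1 := FreeExt.eq_inl_retr_of_dbl_eq_zero 𝒮.X.grading Gen.deg hdbl
  have hw := FreeExt.retr_mem hmem
  set w := FreeExt.retr (x + 𝒮.nextDiff.d y)
  have hdw : 𝒮.X.diff.d w = 0 := by
    apply FreeExt.inl_injective (R := R) (S := 𝒮.Gen)
    rw [← nextDiff_inl, ← h1, map_add, hd, 𝒮.nextDiff.d_squared, add_zero, map_zero]
  obtain ⟨b, hb, hbx⟩ := hφ
  obtain ⟨c, v, hv, hwc⟩ := 𝒮.span w hw hdw ⟨b + 𝒮.nextφ y,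
    Submodule.add_mem _ hb (𝒮.isDGAHom_nextφ.map_degree 1 y hy), by
      rw [map_add, hbx, ← 𝒮.isDGAHom_nextφ.comm_d, ← map_add, h1, nextφ, FreeExt.lift_inl]⟩
  refine ⟨𝒮.genComb c + FreeExt.inl v - y,
    Submodule.sub_mem _ (Submodule.add_mem _ (𝒮.genComb_mem c)
      (FreeExt.inl_mem hv)) hy, ?_⟩
  rw [map_sub, map_add, nextDiff_genComb, nextDiff_inl, ← map_add, ← hwc, ← h1,
    add_sub_cancel_right]

variable (𝒮) in
/-- The cocycles of degree two of the next stage whose image is a coboundary. -/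
noncomputable def nextKer : Submodule R 𝒮.Next :=
  cocycles 𝒮.nextDiff 2 ⊓ ((ℬ 1).map DB.d).comap 𝒮.nextφ.toLinearMap

theorem exists_next [IsDomain R] [IsPrincipalIdealRing R] [Module.Free R A]
    (C : LowContraction 𝒮.nextDiff A) :
    ∃ (K : Type u) (κ : K → 𝒮.Next), (∀ k, κ k ∈ 𝒮.nextKer) ∧
      (∀ c : K →₀ R, ∀ y ∈ 𝒮.nextGrading 1,
        𝒮.nextDiff.d y = Finsupp.linearCombination R κ c → c = 0) ∧
      ∀ z ∈ 𝒮.nextKer, ∃ c, ∃ y ∈ 𝒮.nextGrading 1,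
        z = Finsupp.linearCombination R κ c + 𝒮.nextDiff.d y := by
  let N : Submodule R (𝒮.Gen →₀ R) := 𝒮.nextKer.map (coeff C)
  have : Module.Free R N := free_submodule N
  let b := Module.Free.chooseBasis R N
  have hex : ∀ k, ∃ x ∈ 𝒮.nextKer, coeff C x = b k := fun k => (b k).2
  choose κ hκ hκb using hex
  have hcoeff : ∀ c, coeff C (Finsupp.linearCombination R κ c) = b.repr.symm c := by
    intro c
    have h : coeff C ∘ₗ Finsupp.linearCombination R κ =
        N.subtype ∘ₗ b.repr.symm.toLinearMap := by
      ext k : 2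
      simp [hκb]
    exact DFunLike.congr_fun h c
  refine ⟨_, κ, hκ, ?_, ?_⟩
  · intro c y _ hc
    have h := hcoeff c
    rw [← hc, coeff_d] at h
    exact b.repr.symm.map_eq_zero_iff.1 (Subtype.ext h.symm)
  · intro z hz
    let c := b.repr ⟨coeff C z, z, hz, rfl⟩
    have hmem : z - Finsupp.linearCombination R κ c ∈ 𝒮.nextKer := by
      refine Submodule.sub_mem _ hz ?_
      rw [Finsupp.linearCombination_apply]
      exact Submodule.sum_mem _ fun k _ => Submodule.smul_mem _ _ (hκ k)
    obtain ⟨y, hy, hyz⟩ := next_span_of_coeff_eq_zero C hmem.1.1 hmem.1.2 hmem.2 (by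
      rw [map_sub, hcoeff]
      simp [c])
    exact ⟨c, y, hy, by rw [hyz]; abel⟩

end Stage

end Stages

section Towers

variable {R : Type u} [CommRing R]
  {A : Type u} [Ring A] [Algebra R A] {𝒜 : ℕ → Submodule R A} [GradedAlgebra 𝒜]
  {B : Type u} [Ring B] [Algebra R B] {ℬ : ℕ → Submodule R B} [GradedAlgebra ℬ]
  {DA : Differential R 𝒜} {DB : Differential R ℬ} {f : A →ₐ[R] B}

/-- The stage following a given one. -/
noncomputable def Stage.next [IsDomain R] [IsPrincipalIdealRing R] [Module.Free R A]
    (C : LowContraction DA A) (𝒮 : Stage DA DB f) : Stage DA DB f :=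
  have hr : ∀ n, ∀ x ∈ 𝒮.nextGrading n, 𝒮.r.comp FreeExt.retr x ∈ 𝒜 n :=
    fun n _ hx => 𝒮.r_mem n _ (FreeExt.retr_mem hx)
  have hrι : ∀ a, 𝒮.r.comp FreeExt.retr ((FreeExt.inl (S := 𝒮.Gen)).comp 𝒮.ι a) = a :=
    fun a => by simp [𝒮.rι]
  have C' : LowContraction 𝒮.nextDiff A := C.extend 𝒮.isDGAHom_nextι hr hrι 𝒮.next_zero
  have h := Stage.exists_next C'
  have hκ := h.choose_spec.choose_spec
  { X := ⟨𝒮.Next, 𝒮.nextGrading, 𝒮.nextDiff⟩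
    ι := FreeExt.inl.comp 𝒮.ι
    φ := 𝒮.nextφ
    r := 𝒮.r.comp FreeExt.retr
    hι := 𝒮.isDGAHom_nextι
    hφ := 𝒮.isDGAHom_nextφ
    φι := fun a => (FreeExt.lift_inl _ _ _).trans (𝒮.φι a)
    r_mem := hr
    rι := hrι
    zero := 𝒮.next_zero
    H1 := Stage.next_H1 C'
    K := h.choose
    κ := h.choose_spec.choose
    β := fun k => (hκ.1 k).2.choose
    κ_mem := fun k => (hκ.1 k).1.1
    d_κ := fun k => (hκ.1 k).1.2
    β_mem := fun k => (hκ.1 k).2.choose_spec.1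
    φκ := fun k => (hκ.1 k).2.choose_spec.2.symm
    indep := hκ.2.1
    span := fun z hz hd hb => hκ.2.2 z ⟨⟨hz, hd⟩, hb⟩ }

/-- The initial stage. -/
def Stage.base (hf : IsDGAHom DA DB f)
    (h1 : ∀ x ∈ 𝒜 1, DA.d x = 0 → ∃ y ∈ 𝒜 0, DA.d y = x)
    (h2 : ∀ z ∈ 𝒜 2, DA.d z = 0 → (∃ b ∈ ℬ 1, DB.d b = f z) → ∃ y ∈ 𝒜 1, DA.d y = z) :
    Stage DA DB f where
  X := ⟨A, 𝒜, DA⟩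
  ι := AlgHom.id R A
  φ := f
  r := AlgHom.id R A
  hι := ⟨fun _ _ h => h, fun _ => rfl⟩
  hφ := hf
  φι _ := rfl
  r_mem _ _ h := h
  rι _ := rfl
  zero x hx := ⟨x, hx, rfl⟩
  H1 := h1
  K := PEmpty
  κ := PEmpty.elim
  β := PEmpty.elim
  κ_mem k := k.elim
  d_κ k := k.elim
  β_mem k := k.elim
  φκ k := k.elim
  indep _ _ _ _ := Subsingleton.elim _ _
  span z hz hd hb := by
    obtain ⟨y, hy, hyz⟩ := h2 z hz hd hb
    exact ⟨0, y, hy, by rw [map_zero, zero_add]; exact hyz.symm⟩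

variable (DA DB f) in
/-- A sequence of stages, each one obtained from the preceding one by adjoining generators. -/
structure Tower where
  st : ℕ → Stage DA DB f
  e : ∀ j, (st j).Next ≃ₐ[R] (st (j + 1)).X.carrier
  e_mem : ∀ j n x, x ∈ (st j).nextGrading n ↔ e j x ∈ (st (j + 1)).X.grading n
  e_d : ∀ j x, e j ((st j).nextDiff.d x) = (st (j + 1)).X.diff.d (e j x)
  e_φ : ∀ j x, (st (j + 1)).φ (e j x) = (st j).nextφ x
  e_ι : ∀ j a, e j (FreeExt.inl ((st j).ι a)) = (st (j + 1)).ι a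
  base : ∀ x, ∃ a, (st 0).ι a = x

/-- The tower above a given stage. -/
noncomputable def Stage.tower [IsDomain R] [IsPrincipalIdealRing R] [Module.Free R A]
    (C : LowContraction DA A) (𝒮 : Stage DA DB f) (h : ∀ x, ∃ a, 𝒮.ι a = x) : Tower DA DB f where
  st := Nat.rec 𝒮 fun _ => Stage.next C
  e j := (AlgEquiv.refl :
    (Nat.rec 𝒮 (fun _ => Stage.next C) j : Stage DA DB f).Next ≃ₐ[R] Stage.Next _)
  e_mem _ _ _ := Iff.rfl
  e_d _ _ := rfl
  e_φ _ _ := rfl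
  e_ι _ _ := rfl
  base := h

end Towers

namespace FreeExt

variable {R : Type u} [CommRing R] {A : Type u} [Ring A] [Algebra R A] {S : Type u}

variable (R A) in
/-- The span of the generators of degree `n`. -/
noncomputable def genSpan (deg : S → ℕ) (n : ℕ) : Submodule R (FreeExt R A S) :=
  Submodule.span R (Set.range fun s : {s // deg s = n} => gen s.1)

theorem linearIndependent_gen (h : ∀ c : R, c • (1 : A) = 0 → c = 0) :
    LinearIndependent R (gen : S → FreeExt R A S) := by
  classical
  rw [linearIndependent_iff]
  intro l hl
  ext s
  let δ : FreeExt R A S →ₗ[R] A := der retr retr 0 (by simp) (Pi.single s 1)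
  have h1 : δ ∘ₗ Finsupp.linearCombination R gen =
      LinearMap.toSpanSingleton R A 1 ∘ₗ Finsupp.lapply s := by
    refine Finsupp.lhom_ext' fun t => LinearMap.ext_ring ?_
    by_cases hst : t = s
    · subst hst
      simp [δ]
    · simp [δ, hst]
  have h2 : δ (Finsupp.linearCombination R gen l) = l s • 1 := DFunLike.congr_fun h1 l
  rw [hl, map_zero] at h2
  exact h _ h2.symm

theorem isFreeProductExtension {𝒜 : ℕ → Submodule R A} (h : ∀ c : R, c • (1 : A) = 0 → c = 0)
    (deg : S → ℕ) : IsFreeProductExtension (grading 𝒜 deg) (inl : A →ₐ[R] FreeExt R A S)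
      (genSpan R A deg) := by
  have hgen : ∀ s, (gen s : FreeExt R A S) ∈ genSpan R A deg (deg s) :=
    fun s => Submodule.subset_span ⟨⟨s, rfl⟩, rfl⟩
  refine ⟨fun n => ?_, fun n => ?_, fun C _ _ g k => ⟨lift g fun s => k _ ⟨gen s, hgen s⟩,
    ⟨AlgHom.ext fun a => lift_inl _ _ _, fun n => ?_⟩, fun ψ hψ => ?_⟩⟩
  · refine Submodule.span_le.2 ?_
    rintro _ ⟨⟨s, rfl⟩, rfl⟩
    exact gen_mem s
  · exact Module.Free.of_basis (Module.Basis.span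
      ((linearIndependent_gen h).comp (Subtype.val : {s // deg s = n} → S)
        Subtype.val_injective))
  · rintro ⟨v, hv⟩
    induction hv using Submodule.span_induction with
    | mem x hx =>
      obtain ⟨⟨s, rfl⟩, rfl⟩ := hx
      exact lift_gen _ _ _
    | zero => exact (map_zero _).trans (map_zero (k n)).symm
    | add x y hx hy h1 h2 =>
      exact (map_add _ x y).trans ((congrArg₂ _ h1 h2).trans
        (map_add (k n) ⟨x, hx⟩ ⟨y, hy⟩).symm)
    | smul r x hx h1 =>
      exact (map_smul _ r x).trans ((congrArg _ h1).trans (map_smul (k n) r ⟨x, hx⟩).symm)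
  · refine hom_ext (fun a => ?_) fun s => ?_
    · rw [lift_inl, ← hψ.1, AlgHom.comp_apply]
    · rw [lift_gen]
      exact hψ.2 _ ⟨gen s, hgen s⟩

end FreeExt

section

variable {R : Type u} [CommRing R]
  {A : Type u} [Ring A] [Algebra R A] {𝒜 : ℕ → Submodule R A} [GradedAlgebra 𝒜]
  {B : Type u} [Ring B] [Algebra R B] {ℬ : ℕ → Submodule R B} [GradedAlgebra ℬ]

theorem scaleHom_map_of_mem {g : A →ₐ[R] B} (hg : ∀ n, ∀ a ∈ 𝒜 n, g a ∈ ℬ n) (c : R) (a : A) :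
    scaleHom ℬ c (g a) = g (scaleHom 𝒜 c a) := by
  induction a using homogeneous_induction 𝒜 with
  | hom i a ha => rw [scaleHom_of_mem 𝒜 c ha, scaleHom_of_mem ℬ c (hg i a ha), map_smul]
  | add a b ha hb => rw [map_add, map_add, map_add, map_add, ha, hb]

end

namespace Tower

variable {R : Type u} [CommRing R]
  {A : Type u} [Ring A] [Algebra R A] {𝒜 : ℕ → Submodule R A} [GradedAlgebra 𝒜]
  {B : Type u} [Ring B] [Algebra R B] {ℬ : ℕ → Submodule R B} [GradedAlgebra ℬ]
  {DA : Differential R 𝒜} {DB : Differential R ℬ} {f : A →ₐ[R] B} (𝒯 : Tower DA DB f)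

/-- The generators of all stages. -/
abbrev Gens : Type u := Σ j, (𝒯.st j).Gen

/-- The degree of a generator. -/
def deg (s : 𝒯.Gens) : ℕ := s.2.deg

/-- The union of a tower. -/
abbrev Colim : Type u := FreeExt R A 𝒯.Gens

/-- The grading on the union of a tower. -/
abbrev grading : ℕ → Submodule R 𝒯.Colim := FreeExt.grading 𝒜 𝒯.deg

/-- The inclusion of a stage. -/
noncomputable def incl : ∀ j, (𝒯.st j).X.carrier →ₐ[R] 𝒯.Colim
  | 0 => FreeExt.inl.comp (𝒯.st 0).r
  | j + 1 => (FreeExt.lift (incl j) fun s => FreeExt.gen ⟨j, s⟩).comp (𝒯.e j).symm.toAlgHom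

theorem incl_e (j : ℕ) (x : (𝒯.st j).Next) : 𝒯.incl (j + 1) (𝒯.e j x) =
    FreeExt.lift (𝒯.incl j) (fun s => (FreeExt.gen ⟨j, s⟩ : 𝒯.Colim)) x := by
  simp [incl]

theorem incl_e_inl (j : ℕ) (x : (𝒯.st j).X.carrier) :
    𝒯.incl (j + 1) (𝒯.e j (FreeExt.inl x)) = 𝒯.incl j x := by
  rw [incl_e, FreeExt.lift_inl]

theorem incl_e_gen (j : ℕ) (s : (𝒯.st j).Gen) :
    𝒯.incl (j + 1) (𝒯.e j (FreeExt.gen s)) = FreeExt.gen ⟨j, s⟩ := by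
  rw [incl_e, FreeExt.lift_gen]

theorem incl_ι (j : ℕ) (a : A) : 𝒯.incl j ((𝒯.st j).ι a) = FreeExt.inl a := by
  induction j with
  | zero => simp [incl, (𝒯.st 0).rι]
  | succ j ih => rw [← 𝒯.e_ι, incl_e_inl, ih]

theorem incl_mem (j : ℕ) : ∀ n, ∀ x ∈ (𝒯.st j).X.grading n, 𝒯.incl j x ∈ 𝒯.grading n := by
  induction j with
  | zero => exact fun n x hx => FreeExt.inl_mem ((𝒯.st 0).r_mem n x hx)
  | succ j ih =>
    intro n x hx
    obtain ⟨y, rfl⟩ := (𝒯.e j).surjective x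
    rw [incl_e]
    exact FreeExt.lift_mem ih (fun s => FreeExt.gen_mem (deg := 𝒯.deg) ⟨j, s⟩)
      ((𝒯.e_mem j n y).2 hx)

/-- The boundary of a generator. -/
noncomputable def bd (s : 𝒯.Gens) : 𝒯.Colim := 𝒯.incl s.1 s.2.bd

theorem bd_mem (s : 𝒯.Gens) : 𝒯.bd s ∈ 𝒯.grading (𝒯.deg s + 1) :=
  𝒯.incl_mem _ _ _ s.2.bd_mem

theorem derivation_incl (j : ℕ) (x : (𝒯.st j).X.carrier) :
    FreeExt.derivation 𝒯.deg DA 𝒯.bd (𝒯.incl j x) = 𝒯.incl j ((𝒯.st j).X.diff.d x) := by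
  induction j with
  | zero =>
    obtain ⟨a, rfl⟩ := 𝒯.base x
    rw [← (𝒯.st 0).hι.comm_d, incl_ι, incl_ι, FreeExt.derivation, FreeExt.der_inl]
    rfl
  | succ j ih =>
    obtain ⟨y, rfl⟩ := (𝒯.e j).surjective x
    rw [← 𝒯.e_d]
    induction y using FreeExt.induction with
    | h_inl a => rw [Stage.nextDiff_inl, incl_e_inl, incl_e_inl, ih]
    | h_gen s =>
      rw [Stage.nextDiff_gen, incl_e_inl, incl_e_gen, FreeExt.derivation, FreeExt.der_gen]
      rfl
    | add x y hx hy => simp only [map_add, hx, hy]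
    | mul x y hx hy =>
      have h : scaleHom 𝒯.grading (-1) (𝒯.incl (j + 1) (𝒯.e j x)) =
          𝒯.incl (j + 1) (𝒯.e j (scaleHom (𝒯.st j).nextGrading (-1) x)) :=
        scaleHom_map_of_mem (g := (𝒯.incl (j + 1)).comp (𝒯.e j).toAlgHom)
          (fun n z hz => 𝒯.incl_mem (j + 1) n _ ((𝒯.e_mem j n z).1 hz)) _ x
      rw [map_mul, map_mul, FreeExt.derivation_mul, hx, hy, h, Differential.d_mul, map_add,
        map_add, map_mul, map_mul, map_mul, map_mul, add_comm]

/-- The differential on the union of a tower. -/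
noncomputable def diff : Differential R 𝒯.grading :=
  FreeExt.differential DA 𝒯.bd_mem fun s => by
    rw [bd, derivation_incl, s.2.d_bd, map_zero]

theorem diff_incl (j : ℕ) (x : (𝒯.st j).X.carrier) :
    𝒯.diff.d (𝒯.incl j x) = 𝒯.incl j ((𝒯.st j).X.diff.d x) :=
  𝒯.derivation_incl j x

theorem isDGAHom_inl : IsDGAHom DA 𝒯.diff FreeExt.inl := FreeExt.isDGAHom_inl _ _ _

/-- The map from the union of a tower to `B`. -/
noncomputable def φ : 𝒯.Colim →ₐ[R] B := FreeExt.lift f fun s => s.2.val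

theorem φ_incl (j : ℕ) (x : (𝒯.st j).X.carrier) : 𝒯.φ (𝒯.incl j x) = (𝒯.st j).φ x := by
  induction j with
  | zero =>
    obtain ⟨a, rfl⟩ := 𝒯.base x
    rw [incl_ι, (𝒯.st 0).φι, φ, FreeExt.lift_inl]
  | succ j ih =>
    obtain ⟨y, rfl⟩ := (𝒯.e j).surjective x
    rw [𝒯.e_φ]
    induction y using FreeExt.induction with
    | h_inl a => rw [incl_e_inl, ih, Stage.nextφ, FreeExt.lift_inl]
    | h_gen s => rw [incl_e_gen, φ, FreeExt.lift_gen, Stage.nextφ, FreeExt.lift_gen]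
    | add x y hx hy => simp only [map_add, hx, hy]
    | mul x y hx hy => simp only [map_mul, hx, hy]

theorem isDGAHom_φ (hf : IsDGAHom DA DB f) : IsDGAHom 𝒯.diff DB 𝒯.φ :=
  FreeExt.isDGAHom_lift _ _ _ _ hf (fun s => s.2.val_mem) fun s =>
    (𝒯.φ_incl s.1 s.2.bd).trans s.2.φ_bd

open Classical in
/-- The image of a generator under the retraction onto a stage. -/
noncomputable def retrGen : ∀ j, 𝒯.Gens → (𝒯.st j).X.carrier
  | 0, _ => 0
  | j + 1, s => 𝒯.e j
    (if h : s.1 = j then FreeExt.gen (h ▸ s.2) else FreeExt.inl (retrGen j s))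

/-- The retraction of the union onto a stage. -/
noncomputable def retr (j : ℕ) : 𝒯.Colim →ₐ[R] (𝒯.st j).X.carrier :=
  FreeExt.lift (𝒯.st j).ι (𝒯.retrGen j)

theorem retr_succ_incl {i j : ℕ} (hij : i ≤ j) (x : (𝒯.st i).X.carrier) :
    𝒯.retr (j + 1) (𝒯.incl i x) = 𝒯.e j (FreeExt.inl (𝒯.retr j (𝒯.incl i x))) := by
  induction i with
  | zero =>
    obtain ⟨a, rfl⟩ := 𝒯.base x
    rw [incl_ι, retr, retr, FreeExt.lift_inl, FreeExt.lift_inl, 𝒯.e_ι]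
  | succ i ih =>
    obtain ⟨y, rfl⟩ := (𝒯.e i).surjective x
    induction y using FreeExt.induction with
    | h_inl a => rw [incl_e_inl, ih (by omega)]
    | h_gen s =>
      rw [incl_e_gen, retr, retr, FreeExt.lift_gen, FreeExt.lift_gen, retrGen,
        dif_neg (by simp only; omega)]
    | add x y hx hy => simp only [map_add, hx, hy]
    | mul x y hx hy => simp only [map_mul, hx, hy]

theorem retr_incl (j : ℕ) (x : (𝒯.st j).X.carrier) : 𝒯.retr j (𝒯.incl j x) = x := by
  induction j with
  | zero =>
    obtain ⟨a, rfl⟩ := 𝒯.base x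
    rw [incl_ι, retr, FreeExt.lift_inl]
  | succ j ih =>
    obtain ⟨y, rfl⟩ := (𝒯.e j).surjective x
    induction y using FreeExt.induction with
    | h_inl a => rw [incl_e_inl, 𝒯.retr_succ_incl le_rfl, ih]
    | h_gen s => rw [incl_e_gen, retr, FreeExt.lift_gen, retrGen, dif_pos rfl]
    | add x y hx hy => simp only [map_add, hx, hy]
    | mul x y hx hy => simp only [map_mul, hx, hy]

theorem incl_injective (j : ℕ) : Function.Injective (𝒯.incl j) :=
  Function.LeftInverse.injective (𝒯.retr_incl j)

theorem exists_incl_eq_of_le {i j n : ℕ} (hij : i ≤ j) {x : (𝒯.st i).X.carrier}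
    (hx : x ∈ (𝒯.st i).X.grading n) :
    ∃ y ∈ (𝒯.st j).X.grading n, 𝒯.incl j y = 𝒯.incl i x := by
  induction j, hij using Nat.le_induction with
  | base => exact ⟨x, hx, rfl⟩
  | succ j _ ih =>
    obtain ⟨y, hy, hyx⟩ := ih
    exact ⟨𝒯.e j (FreeExt.inl y), (𝒯.e_mem j n _).1 (FreeExt.inl_mem hy), by
      rw [incl_e_inl, hyx]⟩

theorem exists_incl_eq {n : ℕ} {x : 𝒯.Colim} (hx : x ∈ 𝒯.grading n) :
    ∃ j, ∃ y ∈ (𝒯.st j).X.grading n, 𝒯.incl j y = x := by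
  replace hx : FreeExt.IsHomog 𝒜 𝒯.deg n x := hx
  induction hx with
  | inl n a ha => exact ⟨0, (𝒯.st 0).ι a, (𝒯.st 0).hι.map_degree n a ha, 𝒯.incl_ι 0 a⟩
  | gen s =>
    exact ⟨s.1 + 1, 𝒯.e s.1 (FreeExt.gen s.2), (𝒯.e_mem _ _ _).1 (FreeExt.gen_mem s.2),
      𝒯.incl_e_gen s.1 s.2⟩
  | add n x y _ _ hx hy =>
    obtain ⟨i, a, ha, rfl⟩ := hx
    obtain ⟨j, b, hb, rfl⟩ := hy
    obtain ⟨a', ha', h1⟩ := 𝒯.exists_incl_eq_of_le (le_max_left i j) ha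
    obtain ⟨b', hb', h2⟩ := 𝒯.exists_incl_eq_of_le (le_max_right i j) hb
    exact ⟨_, a' + b', Submodule.add_mem _ ha' hb', by rw [map_add, h1, h2]⟩
  | smul n r x _ hx =>
    obtain ⟨i, a, ha, rfl⟩ := hx
    exact ⟨i, r • a, Submodule.smul_mem _ _ ha, map_smul _ _ _⟩
  | mul k l x y _ _ hx hy =>
    obtain ⟨i, a, ha, rfl⟩ := hx
    obtain ⟨j, b, hb, rfl⟩ := hy
    obtain ⟨a', ha', h1⟩ := 𝒯.exists_incl_eq_of_le (le_max_left i j) ha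
    obtain ⟨b', hb', h2⟩ := 𝒯.exists_incl_eq_of_le (le_max_right i j) hb
    exact ⟨_, a' * b', SetLike.mul_mem_graded ha' hb', by rw [map_mul, h1, h2]⟩

theorem mem_zero {x : 𝒯.Colim} (hx : x ∈ 𝒯.grading 0) : ∃ a ∈ 𝒜 0, FreeExt.inl a = x :=
  FreeExt.mem_zero_iff (deg := 𝒯.deg) (fun s => s.2.one_le_deg) hx

theorem exists_cocycle {x : 𝒯.Colim} {n : ℕ} (hx : x ∈ 𝒯.grading n) (hd : 𝒯.diff.d x = 0) :
    ∃ j, ∃ y ∈ (𝒯.st j).X.grading n, (𝒯.st j).X.diff.d y = 0 ∧ 𝒯.incl j y = x := by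
  obtain ⟨j, y, hy, rfl⟩ := 𝒯.exists_incl_eq hx
  refine ⟨j, y, hy, 𝒯.incl_injective j ?_, rfl⟩
  rw [← diff_incl, hd, map_zero]

theorem exists_d_eq_one {x : 𝒯.Colim} (hx : x ∈ 𝒯.grading 1) (hd : 𝒯.diff.d x = 0) :
    ∃ y ∈ 𝒯.grading 0, 𝒯.diff.d y = x := by
  obtain ⟨j, y, hy, hdy, rfl⟩ := 𝒯.exists_cocycle hx hd
  obtain ⟨w, hw, rfl⟩ := (𝒯.st j).H1 y hy hdy
  exact ⟨_, 𝒯.incl_mem j 0 w hw, 𝒯.diff_incl j w⟩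

theorem exists_incl_eq_d_gen (j : ℕ) {n : ℕ} (hn : 2 ≤ n) {x : (𝒯.st j).X.carrier} {b : B}
    (hx : x ∈ (𝒯.st j).X.grading (n + 1)) (hd : (𝒯.st j).X.diff.d x = 0) (hb : b ∈ ℬ n)
    (h : (𝒯.st j).φ x = DB.d b) :
    ∃ y ∈ 𝒯.grading n, 𝒯.diff.d y = 𝒯.incl j x ∧ 𝒯.φ y = b :=
  let s : (𝒯.st j).Gen := Stage.Gen.ofPair ⟨(n, x, b), hn, hx, hd, hb, h⟩
  ⟨FreeExt.gen ⟨j, s⟩, FreeExt.gen_mem (deg := 𝒯.deg) ⟨j, s⟩,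
    FreeExt.differential_gen _ _ _ _, FreeExt.lift_gen _ _ _⟩

theorem exists_d_eq {n : ℕ} {x : 𝒯.Colim} (hx : x ∈ 𝒯.grading (n + 1))
    (hd : 𝒯.diff.d x = 0) {b : B} (hb : b ∈ ℬ n) (hxb : DB.d b = 𝒯.φ x) (hn : 1 ≤ n) :
    ∃ y ∈ 𝒯.grading n, 𝒯.diff.d y = x := by
  obtain ⟨j, z, hz, hdz, rfl⟩ := 𝒯.exists_cocycle hx hd
  rw [φ_incl] at hxb
  rcases hn.eq_or_lt with rfl | hn
  · obtain ⟨c, v, hv, rfl⟩ := (𝒯.st j).span z hz hdz ⟨b, hb, hxb⟩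
    refine ⟨𝒯.incl (j + 1) (𝒯.e j ((𝒯.st j).genComb c + FreeExt.inl v)),
      𝒯.incl_mem _ _ _ ((𝒯.e_mem _ _ _).1 (Submodule.add_mem _ ((𝒯.st j).genComb_mem c)
        (FreeExt.inl_mem hv))), ?_⟩
    rw [diff_incl, ← 𝒯.e_d, map_add, Stage.nextDiff_genComb, Stage.nextDiff_inl, ← map_add,
      incl_e_inl]
  · obtain ⟨y, hy, hyx, _⟩ := 𝒯.exists_incl_eq_d_gen j hn hz hdz hb hxb.symm
    exact ⟨y, hy, hyx⟩

theorem isQuasiIso (hf : IsDGAHom DA DB f) (hA : ∀ x ∈ 𝒜 0, DA.d x = 0 → ∃ c : R, c • 1 = x)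
    (hB : ∀ x ∈ ℬ 0, DB.d x = 0 → ∃ c : R, c • 1 = x) (hB' : ∀ c : R, c • (1 : B) = 0 → c = 0)
    (hB1 : ∀ x ∈ ℬ 1, DB.d x = 0 → ∃ y ∈ ℬ 0, DB.d y = x) :
    IsQuasiIso 𝒯.diff DB 𝒯.φ (𝒯.isDGAHom_φ hf) := by
  intro n
  refine inducedH_bijective _ _ _ (fun x hx hd hfx => ?_) fun y hy hd => ?_
  · match n with
    | 0 =>
      rw [mem_cobounds_zero] at hfx ⊢
      obtain ⟨a, ha, rfl⟩ := 𝒯.mem_zero hx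
      rw [← 𝒯.isDGAHom_inl.comm_d] at hd
      obtain ⟨c, rfl⟩ := hA a ha (FreeExt.inl_injective (R := R) (hd.trans (map_zero _).symm))
      rw [map_smul, map_one, map_smul, map_one] at hfx
      rw [hB' c hfx, zero_smul, map_zero]
    | 1 => exact (mem_cobounds_succ _).2 (𝒯.exists_d_eq_one hx hd)
    | n + 2 =>
      obtain ⟨b, hb, hbx⟩ := (mem_cobounds_succ _).1 hfx
      exact (mem_cobounds_succ _).2 (𝒯.exists_d_eq hx hd hb hbx (by omega))
  · match n with
    | 0 =>
      obtain ⟨c, rfl⟩ := hB y hy hd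
      refine ⟨c • 1, Submodule.smul_mem _ _ (SetLike.one_mem_graded _), ?_, ?_⟩
      · rw [map_smul, 𝒯.diff.d_one, smul_zero]
      · rw [map_smul, map_one, sub_self]
        exact Submodule.zero_mem _
    | 1 =>
      refine ⟨0, Submodule.zero_mem _, map_zero _, ?_⟩
      rw [map_zero, zero_sub]
      exact Submodule.neg_mem _ ((mem_cobounds_succ _).2 (hB1 y hy hd))
    | n + 2 =>
      obtain ⟨x, hx, hdx, rfl⟩ := 𝒯.exists_incl_eq_d_gen 0 (x := 0) (by omega)
        (Submodule.zero_mem _) (map_zero _) hy (by rw [map_zero, hd])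
      refine ⟨x, hx, by rw [hdx, map_zero], ?_⟩
      rw [sub_self]
      exact Submodule.zero_mem _

end Tower

/-- Proposition 2.1: a morphism `f : (A,d_A) → (B,d_B)` of
`R`-dgas over a principal ideal domain, with `H^0 = R`, `H^1 = 0`, finitely
generated cohomologies, `H^2(B)` free, `A` free as an `R`-module and `H^2(f)`
injective, factors through a relative free model `(A ⊔ TV, d)` whose
differential extends `d_A`, via a quasi-isomorphism `φ` with `φ ∘ i = f`. -/
theorem free_model_of_dga_morphism
    {R : Type u} [CommRing R] [IsDomain R] [IsPrincipalIdealRing R]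
    {A : Type u} [Ring A] [Algebra R A] {𝒜 : ℕ → Submodule R A} [GradedAlgebra 𝒜]
    {B : Type u} [Ring B] [Algebra R B] {ℬ : ℕ → Submodule R B} [GradedAlgebra ℬ]
    (DA : Differential R 𝒜) (DB : Differential R ℬ)
    (hA0 : Nonempty (cohomology DA 0 ≃ₗ[R] R)) (hB0 : Nonempty (cohomology DB 0 ≃ₗ[R] R))
    (hA1 : Subsingleton (cohomology DA 1)) (hB1 : Subsingleton (cohomology DB 1))
    (hAfg : ∀ i : ℕ, Module.Finite R (cohomology DA i))
    (hBfg : ∀ i : ℕ, Module.Finite R (cohomology DB i))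
    (hB2 : Module.Free R (cohomology DB 2))
    (hAfree : Module.Free R A)
    (f : A →ₐ[R] B) (hf : IsDGAHom DA DB f)
    (hf2 : Function.Injective (inducedH DA DB f hf 2)) :
    ∃ (E : GradedDGA R) (ι : A →ₐ[R] E.carrier) (V : ℕ → Submodule R E.carrier)
      (φ : E.carrier →ₐ[R] B) (hφ : IsDGAHom E.diff DB φ),
      IsDGAHom DA E.diff ι ∧
      IsFreeProductExtension E.grading ι V ∧
      IsQuasiIso E.diff DB φ hφ ∧
      φ.comp ι = f := by
  obtain ⟨eA⟩ := hA0
  obtain ⟨eB⟩ := hB0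
  obtain ⟨hA, hA'⟩ := cocycles_zero_of_equiv DA eA
  obtain ⟨hB, hB'⟩ := cocycles_zero_of_equiv DB eB
  have h1 : ∀ x ∈ 𝒜 1, DA.d x = 0 → ∃ y ∈ 𝒜 0, DA.d y = x :=
    fun x hx hd => exists_d_eq_of_subsingleton DA hA1 hx hd
  have h2 : ∀ z ∈ 𝒜 2, DA.d z = 0 → (∃ b ∈ ℬ 1, DB.d b = f z) → ∃ y ∈ 𝒜 1, DA.d y = z :=
    fun z hz hd hb => (mem_cobounds_succ DA).1 (mem_cobounds_of_inducedH_injective DA DB hf hf2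
      hz hd ((mem_cobounds_succ DB).2 hb))
  obtain ⟨C⟩ := exists_lowContraction DA hA hA' h1
  let 𝒯 : Tower DA DB f := (Stage.base hf h1 h2).tower C fun x => ⟨x, rfl⟩
  exact ⟨⟨𝒯.Colim, 𝒯.grading, 𝒯.diff⟩, FreeExt.inl, FreeExt.genSpan R A 𝒯.deg, 𝒯.φ,
    𝒯.isDGAHom_φ hf, 𝒯.isDGAHom_inl, FreeExt.isFreeProductExtension hA' 𝒯.deg,
    𝒯.isQuasiIso hf hA hB hB' fun x hx hd => exists_d_eq_of_subsingleton DB hB1 hx hd,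
    AlgHom.ext fun a => FreeExt.lift_inl _ _ a⟩

end MildTC
end

section
/- Let φ:(A,d)→(B,d) be a surjective morphism of cdgas in CDGA_r(R) whose homology satisfies condition (★). Then secat(φ), defined as the least m for which there exists a cdga morphism r_m:(A^{⊗m+1}⊗ΛW_{(m)},d)→(A,d) with r_m∘i_m=μ_{m+1}, equals the smallest m for which the pushout inclusion j_m:(A,d)↪(A⊗ΛW_{(m)},d) admits a cdga retraction. Moreover, if X is a finite-type (r,ρ(R))-mild CW-complex with H_*(ΩX;R) torsion free, and (ΛV,d)→C^*(L) is a decomposable minimal commutative model of the Chevalley–Eilenberg complex C^*(L) of its Lie model L, then TC_n(X,R)=secat(μ_{ΛV,n}). -/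
/-!
Common framework: graded differential algebras over a commutative ring `R`,
their cohomology, quasi-isomorphisms, free (product) and free commutative
extensions (relative free models `A ⊔ TV` and relative commutative models
`A ⊗ ΛV`), minimality, H-mildness, and the packages of data used to define
`secat`, `sc` and their variants following Benzaki–Rami.
-/

namespace MildTC

universe u

section HomogeneousGenerators

variable {R : Type u} [CommRing R]

theorem Differential.map_one {A : Type u} [Ring A] [Algebra R A] {𝒜 : ℕ → Submodule R A}
    [SetLike.GradedMonoid 𝒜] (D : Differential R 𝒜) : D.d 1 = 0 := by
  have h := D.leibniz 0 0 1 SetLike.GradedOne.one_mem 1 SetLike.GradedOne.one_mem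
  simpa using h

variable (G : GradedDGA R) {s : Set G.carrier}

/-- Products of homogeneous generators are homogeneous, and their differentials stay in the
subalgebra as soon as this holds for the generators. -/
theorem exists_mem_grading_of_mem_closure
    (hs : ∀ x ∈ s, ∃ i, x ∈ G.grading i)
    (hd : ∀ x ∈ s, G.diff.d x ∈ Algebra.adjoin R s)
    {x : G.carrier} (hx : x ∈ Submonoid.closure s) :
    ∃ i, x ∈ G.grading i ∧ x ∈ Algebra.adjoin R s ∧ G.diff.d x ∈ Algebra.adjoin R s := by
  induction hx using Submonoid.closure_induction with
  | mem x hx =>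
    obtain ⟨i, hi⟩ := hs x hx
    exact ⟨i, hi, Algebra.subset_adjoin hx, hd x hx⟩
  | one =>
    refine ⟨0, SetLike.GradedOne.one_mem, one_mem _, ?_⟩
    rw [G.diff.map_one]
    exact zero_mem _
  | mul x y _ _ ihx ihy =>
    obtain ⟨i, hi, hxs, hdx⟩ := ihx
    obtain ⟨j, hj, hys, hdy⟩ := ihy
    refine ⟨i + j, SetLike.GradedMul.mul_mem hi hj, mul_mem hxs hys, ?_⟩
    rw [G.diff.leibniz i j x hi y hj]
    exact add_mem (mul_mem hdx hys) (zsmul_mem (mul_mem hxs hdy) _)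

theorem mem_span_closure_of_mem_adjoin {x : G.carrier} (hx : x ∈ Algebra.adjoin R s) :
    x ∈ Submodule.span R (Submonoid.closure s : Set G.carrier) := by
  rw [← Algebra.adjoin_eq_span]
  exact hx

theorem d_mem_adjoin
    (hs : ∀ x ∈ s, ∃ i, x ∈ G.grading i)
    (hd : ∀ x ∈ s, G.diff.d x ∈ Algebra.adjoin R s)
    {x : G.carrier} (hx : x ∈ Algebra.adjoin R s) : G.diff.d x ∈ Algebra.adjoin R s := by
  replace hx := mem_span_closure_of_mem_adjoin G hx
  induction hx using Submodule.span_induction with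
  | mem x h => exact (exists_mem_grading_of_mem_closure G hs hd h).choose_spec.2.2
  | zero => simp
  | add x y _ _ ihx ihy =>
    rw [map_add]
    exact add_mem ihx ihy
  | smul a x _ ihx =>
    rw [map_smul]
    exact Subalgebra.smul_mem _ ihx a

/-- The sub-dga generated by a set of homogeneous elements whose differentials lie in the
subalgebra they generate. -/
noncomputable def adjoinDGA (s : Set G.carrier)
    (hs : ∀ x ∈ s, ∃ i, x ∈ G.grading i)
    (hd : ∀ x ∈ s, G.diff.d x ∈ Algebra.adjoin R s) : GradedDGA R :=
  let 𝒮 : ℕ → Submodule R (Algebra.adjoin R s) := fun i =>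
    (G.grading i).comap (Algebra.adjoin R s).val.toLinearMap
  have h_ind : iSupIndep 𝒮 := by
    have hG := (DirectSum.Decomposition.isInternal G.grading).submodule_iSupIndep
    rw [iSupIndep_iff_finsetSum_eq_zero_imp_eq_zero] at hG ⊢
    intro t v hv h0 i hi
    have h := hG t (fun i => (v i : G.carrier)) (fun i hi => hv i hi)
      (by simpa using congrArg (Algebra.adjoin R s).val h0) i hi
    exact Subtype.ext h
  have h_top : iSup 𝒮 = ⊤ := by
    have key : ∀ x (hx : x ∈ Submodule.span R (Submonoid.closure s : Set G.carrier)),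
        ∃ hx' : x ∈ Algebra.adjoin R s, (⟨x, hx'⟩ : Algebra.adjoin R s) ∈ iSup 𝒮 := by
      intro x hx
      induction hx using Submodule.span_induction with
      | mem x h =>
        obtain ⟨i, hi, hxs, -⟩ := exists_mem_grading_of_mem_closure G hs hd h
        exact ⟨hxs, Submodule.mem_iSup_of_mem (p := 𝒮) i hi⟩
      | zero => exact ⟨zero_mem _, zero_mem (iSup 𝒮)⟩
      | add x y _ _ ihx ihy =>
        obtain ⟨hx, hx'⟩ := ihx
        obtain ⟨hy, hy'⟩ := ihy
        exact ⟨add_mem hx hy, add_mem hx' hy'⟩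
      | smul a x _ ihx =>
        obtain ⟨hx, hx'⟩ := ihx
        exact ⟨Subalgebra.smul_mem _ hx a, Submodule.smul_mem _ a hx'⟩
    rw [eq_top_iff]
    rintro ⟨x, hx⟩ -
    exact (key x (mem_span_closure_of_mem_adjoin G hx)).2
  letI : DirectSum.Decomposition 𝒮 :=
    ((DirectSum.isInternal_submodule_iff_iSupIndep_and_iSup_eq_top 𝒮).2
      ⟨h_ind, h_top⟩).chooseDecomposition
  haveI : SetLike.GradedMonoid 𝒮 :=
    { one_mem := (SetLike.GradedOne.one_mem : (1 : G.carrier) ∈ G.grading 0)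
      mul_mem := fun _ _ _ _ ha hb =>
        (SetLike.GradedMul.mul_mem (A := G.grading) ha hb) }
  letI : GradedAlgebra 𝒮 := { }
  { carrier := Algebra.adjoin R s
    grading := 𝒮
    diff :=
      { d := G.diff.d.restrict (p := (Algebra.adjoin R s).toSubmodule)
          (q := (Algebra.adjoin R s).toSubmodule) fun _ hx => d_mem_adjoin G hs hd hx
        d_squared := fun a => Subtype.ext (G.diff.d_squared a)
        d_degree := fun i a ha => G.diff.d_degree i a ha
        leibniz := fun i j a ha b hb =>
          Subtype.ext (G.diff.leibniz i j a ha b hb) } }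

variable {A : Type u} [Ring A] [Algebra R A] {𝒜 : ℕ → Submodule R A} [GradedAlgebra 𝒜]

/-- Compatibility with gradings and differentials can be checked on homogeneous generators. -/
theorem isDGAHom_of_adjoin_eq_top (DA : Differential R 𝒜) (hs : Algebra.adjoin R s = ⊤)
    (h : G.carrier →ₐ[R] A)
    (hgen : ∀ x ∈ s, ∃ i, x ∈ G.grading i ∧ h x ∈ 𝒜 i ∧ h (G.diff.d x) = DA.d (h x)) :
    IsDGAHom G.diff DA h := by
  have hcl : ∀ x ∈ Submonoid.closure s,
      ∃ i, x ∈ G.grading i ∧ h x ∈ 𝒜 i ∧ h (G.diff.d x) = DA.d (h x) := by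
    intro x hx
    induction hx using Submonoid.closure_induction with
    | mem x hx => exact hgen x hx
    | one =>
      refine ⟨0, SetLike.GradedOne.one_mem, ?_, ?_⟩
      · rw [map_one]
        exact SetLike.GradedOne.one_mem
      · rw [G.diff.map_one, map_one, DA.map_one, map_zero]
    | mul x y _ _ ihx ihy =>
      obtain ⟨i, hxi, hhx, hdx⟩ := ihx
      obtain ⟨j, hyj, hhy, hdy⟩ := ihy
      refine ⟨i + j, SetLike.GradedMul.mul_mem hxi hyj, ?_, ?_⟩
      · rw [map_mul]
        exact SetLike.GradedMul.mul_mem hhx hhy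
      · rw [G.diff.leibniz i j x hxi y hyj, map_mul, DA.leibniz i j _ hhx _ hhy, map_add,
          map_zsmul, map_mul, map_mul, hdx, hdy]
  have hspan : ∀ x, x ∈ Submodule.span R (Submonoid.closure s : Set G.carrier) := fun x =>
    mem_span_closure_of_mem_adjoin G (hs ▸ Algebra.mem_top)
  refine ⟨?_, fun x => ?_⟩
  · intro i x hx
    rw [← DirectSum.decompose_of_mem_same G.grading hx]
    clear hx
    induction hspan x using Submodule.span_induction with
    | mem x hx =>
      obtain ⟨k, hk, hhk, -⟩ := hcl x hx
      by_cases hki : k = i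
      · subst hki
        rwa [DirectSum.decompose_of_mem_same G.grading hk]
      · rw [DirectSum.decompose_of_mem_ne G.grading hk hki, map_zero]
        exact zero_mem _
    | zero => simp
    | add x y _ _ ihx ihy =>
      rw [DirectSum.decompose_add, DirectSum.add_apply, Submodule.coe_add, map_add]
      exact add_mem ihx ihy
    | smul a x _ ihx =>
      rw [DirectSum.decompose_smul, DirectSum.smul_apply, Submodule.coe_smul, map_smul]
      exact Submodule.smul_mem _ a ihx
  · induction hspan x using Submodule.span_induction with
    | mem x hx => exact (hcl x hx).choose_spec.2.2
    | zero => simp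
    | add x y _ _ ihx ihy => simp only [map_add, ihx, ihy]
    | smul a x _ ihx => simp only [map_smul, ihx]

end HomogeneousGenerators

section Pushout

variable {R : Type u} [CommRing R]
variable {A : Type u} [Ring A] [Algebra R A] {𝒜 : ℕ → Submodule R A}
variable {B : Type u} [Ring B] [Algebra R B] {ℬ : ℕ → Submodule R B}
variable {DA : Differential R 𝒜} {DB : Differential R ℬ} {φ : A →ₐ[R] B} {m : ℕ}

/-- The homogeneous elements of the pushout coming from its two legs. -/
def SecatPackage.generators (S : SecatPackage DA DB φ m) : Set S.F.carrier :=
  {x | (∃ i, ∃ e ∈ S.E.grading i, S.bar e = x) ∨ ∃ i, ∃ a ∈ 𝒜 i, S.j a = x}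

theorem SecatPackage.bar_mem_adjoin (S : SecatPackage DA DB φ m) (e : S.E.carrier) :
    S.bar e ∈ Algebra.adjoin R S.generators := by
  induction e using DirectSum.Decomposition.inductionOn S.E.grading with
  | zero => simp
  | @homogeneous i e => exact Algebra.subset_adjoin (Or.inl ⟨i, e, e.2, rfl⟩)
  | add x y hx hy =>
    rw [map_add]
    exact add_mem hx hy

variable [GradedAlgebra 𝒜]

theorem SecatPackage.j_mem_adjoin (S : SecatPackage DA DB φ m) (a : A) :
    S.j a ∈ Algebra.adjoin R S.generators := by
  induction a using DirectSum.Decomposition.inductionOn 𝒜 with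
  | zero => simp
  | @homogeneous i a => exact Algebra.subset_adjoin (Or.inr ⟨i, a, a.2, rfl⟩)
  | add x y hx hy =>
    rw [map_add]
    exact add_mem hx hy

/-- The pushout is generated by the images of its two legs. -/
theorem SecatPackage.adjoin_generators (S : SecatPackage DA DB φ m) :
    Algebra.adjoin R S.generators = ⊤ := by
  have hs : ∀ x ∈ S.generators, ∃ i, x ∈ S.F.grading i := by
    rintro _ (⟨i, e, he, rfl⟩ | ⟨i, a, ha, rfl⟩)
    · exact ⟨i, S.bar_dga.map_degree i e he⟩
    · exact ⟨i, S.j_dga.map_degree i a ha⟩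
  have hd : ∀ x ∈ S.generators, S.F.diff.d x ∈ Algebra.adjoin R S.generators := by
    rintro _ (⟨i, e, he, rfl⟩ | ⟨i, a, ha, rfl⟩)
    · rw [← S.bar_dga.comm_d]
      exact S.bar_mem_adjoin _
    · rw [← S.j_dga.comm_d]
      exact S.j_mem_adjoin _
  let C : GradedDGA R := adjoinDGA S.F S.generators hs hd
  let incl : C.carrier →ₐ[R] S.F.carrier := (Algebra.adjoin R S.generators).val
  let τ : S.E.carrier →ₐ[R] C.carrier :=
    S.bar.codRestrict (Algebra.adjoin R S.generators) S.bar_mem_adjoin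
  let g : A →ₐ[R] C.carrier :=
    S.j.codRestrict (Algebra.adjoin R S.generators) S.j_mem_adjoin
  have hC : GradedComm C.grading := fun i j a ha b hb =>
    Subtype.ext (S.Fcomm i j a.1 ha b.1 hb)
  have hτ : IsDGAHom S.E.diff C.diff τ :=
    ⟨fun i e he => S.bar_dga.map_degree i e he, fun e => Subtype.ext (S.bar_dga.comm_d e)⟩
  have hg : IsDGAHom DA C.diff g :=
    ⟨fun i a ha => S.j_dga.map_degree i a ha, fun a => Subtype.ext (S.j_dga.comm_d a)⟩
  obtain ⟨h, ⟨hbar, hj⟩, -⟩ := S.pushout C hC τ hτ g hg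
    (AlgHom.ext fun x => Subtype.ext (DFunLike.congr_fun S.square x))
  have hid : incl.comp h = AlgHom.id R S.F.carrier := by
    refine (S.pushout S.F S.Fcomm S.bar S.bar_dga S.j S.j_dga S.square).unique
      ⟨?_, ?_⟩ ⟨AlgHom.id_comp _, AlgHom.id_comp _⟩
    · rw [AlgHom.comp_assoc, hbar]
      rfl
    · rw [AlgHom.comp_assoc, hj]
      rfl
  rw [eq_top_iff]
  intro x _
  have hx : incl (h x) = x := DFunLike.congr_fun hid x
  rw [← hx]
  exact (h x).2

/-- Lifts of `μ_{m+1}` through `i_m` correspond to retractions of `j_m`. -/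
theorem SecatPackage.exists_lift_iff_exists_retraction (hA : GradedComm 𝒜)
    (S : SecatPackage DA DB φ m) :
    (∃ τ : S.E.carrier →ₐ[R] A, IsDGAHom S.E.diff DA τ ∧ τ.comp S.i = S.mul) ↔
      ∃ ret : S.F.carrier →ₐ[R] A,
        IsDGAHom S.F.diff DA ret ∧ ret.comp S.j = AlgHom.id R A := by
  constructor
  · rintro ⟨τ, hτ, hτi⟩
    obtain ⟨h, ⟨hbar, hj⟩, -⟩ := S.pushout ⟨A, 𝒜, DA⟩ hA τ hτ (AlgHom.id R A)
      ⟨fun _ _ ha => ha, fun _ => rfl⟩ (by rw [hτi, AlgHom.id_comp])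
    have hbar' : ∀ e, h (S.bar e) = τ e := DFunLike.congr_fun hbar
    have hj' : ∀ a, h (S.j a) = a := DFunLike.congr_fun hj
    refine ⟨h, isDGAHom_of_adjoin_eq_top S.F DA S.adjoin_generators h ?_, hj⟩
    rintro _ (⟨i, e, he, rfl⟩ | ⟨i, a, ha, rfl⟩)
    · refine ⟨i, S.bar_dga.map_degree i e he, ?_, ?_⟩
      · rw [hbar']
        exact hτ.map_degree i e he
      · rw [← S.bar_dga.comm_d, hbar', hbar', hτ.comm_d]
    · refine ⟨i, S.j_dga.map_degree i a ha, ?_, ?_⟩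
      · rwa [hj']
      · rw [← S.j_dga.comm_d, hj', hj']
  · rintro ⟨ret, hret, hj⟩
    refine ⟨ret.comp S.bar, ⟨fun i e he => hret.map_degree i _ (S.bar_dga.map_degree i e he),
      fun e => ?_⟩, ?_⟩
    · rw [AlgHom.comp_apply, AlgHom.comp_apply, S.bar_dga.comm_d, hret.comm_d]
    · rw [AlgHom.comp_assoc, S.square, ← AlgHom.comp_assoc, hj, AlgHom.id_comp]

theorem leastNat_lift_eq_secat (hA : GradedComm 𝒜) (S : ∀ m : ℕ, SecatPackage DA DB φ m) :
    leastNat (fun m => ∃ τ : (S m).E.carrier →ₐ[R] A,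
      IsDGAHom (S m).E.diff DA τ ∧ τ.comp (S m).i = (S m).mul) = secat S :=
  congrArg leastNat <| funext fun m =>
    propext ((S m).exists_lift_iff_exists_retraction hA)

end Pushout

/-- Proposition 3.1: for a surjective morphism `φ` of cdgas in
`CDGA_r(R)` whose homology satisfies (★), `secat(φ)` — the least `m` admitting
a cdga morphism `r_m : (A^{⊗m+1} ⊗ ΛW_{(m)},d) → (A,d)` with
`r_m ∘ i_m = μ_{m+1}` — coincides with the least `m` for which the pushout
inclusion `j_m` admits a cdga retraction; in particular, for a finite-type
`(r,ρ(R))`-mild CW-complex `X` with `H_*(ΩX;R)` torsion free and decomposable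
minimal commutative model `(ΛV,d)`, `TC_n(X,R) = secat(μ_{ΛV,n})`. -/
theorem secat_eq_least_retraction
    {R : Type u} [CommRing R] [IsDomain R] [IsPrincipalIdealRing R]
    (h2 : IsUnit (2 : R)) (r : ℕ)
    {A : Type u} [Ring A] [Algebra R A] {𝒜 : ℕ → Submodule R A} [GradedAlgebra 𝒜]
    {B : Type u} [Ring B] [Algebra R B] {ℬ : ℕ → Submodule R B} [GradedAlgebra ℬ]
    (DA : Differential R 𝒜) (DB : Differential R ℬ)
    (hAc : GradedComm 𝒜) (hBc : GradedComm ℬ)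
    (hAmild : IsHMild DA r ((r : ℕ∞) * rhoPID R))
    (hBmild : IsHMild DB r ((r : ℕ∞) * rhoPID R))
    (hAstar : StarCondition DA r) (hBstar : StarCondition DB r)
    (φ : A →ₐ[R] B) (hφ : IsDGAHom DA DB φ) (hsurj : Function.Surjective φ)
    (S : ∀ m : ℕ, SecatPackage DA DB φ m) :
    (leastNat (fun m => ∃ τ : (S m).E.carrier →ₐ[R] A,
        IsDGAHom (S m).E.diff DA τ ∧ τ.comp (S m).i = (S m).mul) = secat S) ∧
    (∀ (r' n : ℕ) (Xm : MildSpaceModel R r') (Tn : GradedDGA R)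
        (incl : Fin n → (Xm.M.carrier →ₐ[R] Tn.carrier)),
      IsTensorPower Xm.M.diff n Tn incl →
      ∀ (μ : Tn.carrier →ₐ[R] Xm.M.carrier), IsDGAHom Tn.diff Xm.M.diff μ →
      (∀ j, μ.comp (incl j) = AlgHom.id R Xm.M.carrier) →
      Function.Surjective μ →
      ∀ (Sμ : ∀ m : ℕ, SecatPackage Tn.diff Xm.M.diff μ m),
        leastNat (fun m => ∃ τ : (Sμ m).E.carrier →ₐ[R] Tn.carrier,
          IsDGAHom (Sμ m).E.diff Tn.diff τ ∧ τ.comp (Sμ m).i = (Sμ m).mul)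
          = secat Sμ) := by
  refine ⟨leastNat_lift_eq_secat hAc S, ?_⟩
  intro r' n Xm Tn incl hT μ _ _ _ Sμ
  exact leastNat_lift_eq_secat hT.1 Sμ


end MildTC
end
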